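/- Let d ≥ 2, α ∈ (0,1), and let μ be a nondegenerate α-stable distribution on ℝ^d with no shift and characteristic exponent Φ_μ(z) = |z|^α V(u_z); let g be the density of μ. For x ≠ 0 and j ∈ ℤ_+ define φ_j(x) = Σ_{k=1}^∞ ((−2^α)^k π^{−d/2} / (k! |x|^{kα+d})) (Γ((j+kα+d)/2) / Γ((j−kα)/2)) S_{j,k}(u_x), where S_{j,k} = (−i)^j proj_j(V^k). Then: (1) the series defining φ_j converges absolutely, uniformly on {x : |x| ≥ c} for every c > 0; (2) for every r > 0, the function u ↦ φ_j(ru) belongs to ℋ_{j,d}, and proj_j(g(r·)) = φ_j(r·), so that g(r·) = Σ_{j=0}^∞ φ_j(r·) in L²(S^{d−1}, ω). -/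

import Mathlib

open MeasureTheory Real Filter Topology
open scoped RealInnerProductSpace ENNReal NNReal

noncomputable section

namespace StablePaper

abbrev Ed (d : ℕ) : Type := EuclideanSpace ℝ (Fin d)

abbrev Sph (d : ℕ) := Metric.sphere (0 : Ed d) 1

/-- The surface measure `ω` on the unit sphere `S^{d-1}`. -/
def ωd (d : ℕ) : Measure (Sph d) := (volume : Measure (Ed d)).toSphere

/-- `u_z = z/|z|` for `z ≠ 0`, as a point of the unit sphere. -/
def unitize {d : ℕ} (z : Ed d) (hz : z ≠ 0) : Sph d :=
  ⟨‖z‖⁻¹ • z, by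
    rw [mem_sphere_iff_norm, sub_zero, norm_smul, norm_inv, norm_norm,
      inv_mul_cancel₀ (norm_ne_zero_iff.mpr hz)]⟩

/-- Negation on the unit sphere. -/
def negS {d : ℕ} (u : Sph d) : Sph d :=
  ⟨-(u : Ed d), by
    rw [mem_sphere_iff_norm, sub_zero, norm_neg]
    have := u.2
    rwa [mem_sphere_iff_norm, sub_zero] at this⟩

/-- Rising factorial (Pochhammer symbol) `(b)_n`. -/
def risingFactorial (b : ℝ) (n : ℕ) : ℝ := ∏ i ∈ Finset.range n, (b + i)

/-- The Gegenbauer polynomial `C_j^b(t)` (for `b > 0`), via its explicit sum formula. -/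
def gegenbauer (b : ℝ) (j : ℕ) (t : ℝ) : ℝ :=
  ∑ m ∈ Finset.range (j / 2 + 1),
    (-1 : ℝ) ^ m * 2 ^ (j - 2 * m) * risingFactorial b (j - m) /
      ((Nat.factorial m : ℝ) * (Nat.factorial (j - 2 * m) : ℝ)) * t ^ (j - 2 * m)

/-- The normalized (ultraspherical) polynomial `C̃_j^b(t) = C_j^b(t)/C_j^b(1)`;
for `b = 0` it is the Chebyshev polynomial `T_j`. -/
def gegenbauerN (b : ℝ) (j : ℕ) (t : ℝ) : ℝ :=
  if b = 0 then (Polynomial.Chebyshev.T ℝ (j : ℤ)).eval t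
  else gegenbauer b j t / gegenbauer b j 1

/-- `c_{j,d} = dim ℋ_{j,d}`. -/
def cdim (d j : ℕ) : ℕ :=
  if j = 0 then 1 else Nat.choose (j + d - 2) j + Nat.choose (j + d - 3) (j - 1)

/-- The surface area `A(S^{d-1}) = 2 π^{d/2} / Γ(d/2)`. -/
def sphereArea (d : ℕ) : ℝ := 2 * Real.pi ^ ((d : ℝ) / 2) / Real.Gamma ((d : ℝ) / 2)

/-- Projection onto spherical harmonics of degree `j` (real-valued version):
`(proj_j f)(u) = (c_{j,d}/A(S^{d-1})) ∫ C̃_j^{(d-2)/2}(⟨u,v⟩) f(v) ω(dv)`. -/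
def projR (d j : ℕ) (f : Sph d → ℝ) (u : Sph d) : ℝ :=
  (cdim d j : ℝ) / sphereArea d *
    ∫ v, gegenbauerN (((d : ℝ) - 2) / 2) j ⟪(u : Ed d), (v : Ed d)⟫ * f v ∂(ωd d)

/-- Projection onto spherical harmonics of degree `j` (complex-valued version). -/
def projC (d j : ℕ) (f : Sph d → ℂ) (u : Sph d) : ℂ :=
  ((cdim d j : ℂ) / (sphereArea d : ℂ)) *
    ∫ v, (gegenbauerN (((d : ℝ) - 2) / 2) j ⟪(u : Ed d), (v : Ed d)⟫ : ℂ) * f v ∂(ωd d)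

/-- The coefficients `w_j(α)`. -/
def w (d : ℕ) (α : ℝ) (j : ℕ) : ℝ :=
  Real.pi ^ ((d : ℝ) / 2) * Real.Gamma (α + 1) /
    (2 ^ (α - 1) * Real.Gamma (((j : ℝ) + α + d) / 2) * Real.Gamma ((α - j) / 2 + 1))

/-- The characteristic exponent of an `α`-stable distribution (`α ≠ 1`) with
spectral spherical measure `Λ`. -/
def charExp (d : ℕ) (α : ℝ) (Λ : Measure (Sph d)) (z : Ed d) : ℂ :=
  ∫ v, (|⟪z, (v : Ed d)⟫| ^ α : ℝ) *
      (1 - Complex.I * (Real.tan (Real.pi * α / 2) : ℂ) *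
        (Real.sign ⟪z, (v : Ed d)⟫ : ℂ)) ∂Λ

/-- `V(u)`, so that `Φ_μ(z) = |z|^α V(u_z)`. -/
def Vfun (d : ℕ) (α : ℝ) (Λ : Measure (Sph d)) (u : Sph d) : ℂ :=
  charExp d α Λ (u : Ed d)

/-- The characteristic exponent of a `1`-stable distribution with
spectral spherical measure `Λ`. -/
def charExp1 (d : ℕ) (Λ : Measure (Sph d)) (z : Ed d) : ℂ :=
  ∫ v, ((|⟪z, (v : Ed d)⟫| : ℝ) : ℂ) +
      Complex.I * ((2 / Real.pi * (⟪z, (v : Ed d)⟫ *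
        Real.log |⟪z, (v : Ed d)⟫|) : ℝ) : ℂ) ∂Λ

/-- The spectral spherical measure `λ(dv) = P(v) ω(dv)`. -/
def specMeasure (d : ℕ) (P : Sph d → ℝ) : Measure (Sph d) :=
  (ωd d).withDensity (fun v => ENNReal.ofReal (P v))

/-- `μ` has Fourier transform `exp (-Φ)` where `Φ` is the `α`-stable characteristic
exponent with spectral spherical measure `Λ` (case `α ≠ 1`). -/
def IsStableChar (d : ℕ) (α : ℝ) (Λ : Measure (Sph d)) (μ : Measure (Ed d)) : Prop :=
  ∀ z : Ed d, ∫ x, Complex.exp (Complex.I * (⟪z, x⟫ : ℂ)) ∂μ =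
    Complex.exp (- charExp d α Λ z)

/-- `μ` has Fourier transform `exp (-Φ)` where `Φ` is the `1`-stable characteristic
exponent with spectral spherical measure `Λ`. -/
def IsStableChar1 (d : ℕ) (Λ : Measure (Sph d)) (μ : Measure (Ed d)) : Prop :=
  ∀ z : Ed d, ∫ x, Complex.exp (Complex.I * (⟪z, x⟫ : ℂ)) ∂μ =
    Complex.exp (- charExp1 d Λ z)

/-- `μ` is nondegenerate: its support is not contained in any proper affine subspace. -/
def Nondegenerate (d : ℕ) (μ : Measure (Ed d)) : Prop :=
  ∀ (a : Ed d) (W : Submodule ℝ (Ed d)), W ≠ ⊤ →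
    μ ((fun x => a + x) '' (W : Set (Ed d))) < 1

/-- `P` is the restriction to the sphere of a polynomial on `ℝ^d`. -/
def IsPolyRestriction (d : ℕ) (P : Sph d → ℝ) : Prop :=
  ∃ p : MvPolynomial (Fin d) ℝ,
    ∀ u : Sph d, P u = MvPolynomial.eval (fun i => (u : Ed d) i) p

/-- `P` is the restriction to the sphere of a polynomial of degree at most `q`. -/
def IsPolyRestrictionDeg (d q : ℕ) (P : Sph d → ℝ) : Prop :=
  ∃ p : MvPolynomial (Fin d) ℝ, p.totalDegree ≤ q ∧
    ∀ u : Sph d, P u = MvPolynomial.eval (fun i => (u : Ed d) i) p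

/-- `f` is a spherical harmonic of degree `j`: the restriction to the sphere of a
homogeneous harmonic polynomial of degree `j`. -/
def IsSphericalHarmonicC (d j : ℕ) (f : Sph d → ℂ) : Prop :=
  ∃ p : MvPolynomial (Fin d) ℂ, p.IsHomogeneous j ∧
    (∑ i : Fin d, MvPolynomial.pderiv i (MvPolynomial.pderiv i p)) = 0 ∧
    ∀ u : Sph d, f u = MvPolynomial.eval (fun i => ((u : Ed d) i : ℂ)) p

/-- `S_{j,k} = (-i)^j proj_j (V^k)`. -/
def SHk (d : ℕ) (α : ℝ) (Λ : Measure (Sph d)) (j k : ℕ) (u : Sph d) : ℂ :=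
  (-Complex.I) ^ j * projC d j (fun v => (Vfun d α Λ v) ^ k) u

/-- `S_{j,p} = (-i)^j proj_j (V^p)` for real exponents `p` (principal branch). -/
def SHp (d : ℕ) (α : ℝ) (Λ : Measure (Sph d)) (j : ℕ) (p : ℝ) (u : Sph d) : ℂ :=
  (-Complex.I) ^ j * projC d j (fun v => (Vfun d α Λ v) ^ (p : ℂ)) u

/-- `g` is the density of the stable distribution with characteristic exponent
`charExp d α Λ`, given by the Fourier inversion formula. -/
def IsDensityOf (d : ℕ) (α : ℝ) (Λ : Measure (Sph d)) (g : Ed d → ℝ) : Prop :=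
  ∀ x : Ed d, (g x : ℂ) =
    (((2 * Real.pi) ^ d)⁻¹ : ℝ) *
      ∫ z : Ed d, Complex.exp (-(Complex.I * (⟪x, z⟫ : ℂ))) *
        Complex.exp (- charExp d α Λ z)

/-- Harmonic numbers `s_n`. -/
def harmonicNum (n : ℕ) : ℝ := ∑ i ∈ Finset.range n, (1 : ℝ) / (i + 1)

def betaD (d : ℕ) : ℝ :=
  if Even d then 1 - Real.log 2 - harmonicNum (d / 2) / 2
  else 1 - harmonicNum (d + 1) + harmonicNum ((d + 1) / 2) / 2

/-- The coefficients `w*_j` (for odd `j`). -/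
def wstar (d j : ℕ) : ℝ :=
  if j = 1 then Real.pi ^ ((d : ℝ) / 2) * betaD d / Real.Gamma ((d : ℝ) / 2 + 1)
  else (-1 : ℝ) ^ ((j - 3) / 2) * Real.pi ^ ((d : ℝ) / 2) *
      Real.Gamma (((j : ℝ) - 1) / 2) / (2 * Real.Gamma (((d : ℝ) + 1 + j) / 2))

/-- The Bessel function of the first kind `J_τ`. -/
def besselJ (τ : ℝ) (x : ℝ) : ℝ :=
  ∑' k : ℕ, (-1 : ℝ) ^ k * (x / 2) ^ (2 * (k : ℝ) + τ) /
    ((Nat.factorial k : ℝ) * Real.Gamma ((k : ℝ) + τ + 1))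

/-- The `(j,k)`-term `((-2^α)^k π^{-d/2} / (k! ρ^{kα+d})) (Γ((j+kα+d)/2)/Γ((j-kα)/2)) S_{j,k}(u)`
of the spherical-harmonic series for the density (`α ∈ (0,1)`), at radius `ρ`. -/
def phiTerm (d : ℕ) (α : ℝ) (Λ : Measure (Sph d)) (j k : ℕ) (ρ : ℝ) (u : Sph d) : ℂ :=
  ((((-((2 : ℝ) ^ α)) ^ k * Real.pi ^ (-(d : ℝ) / 2) /
      ((Nat.factorial k : ℝ) * ρ ^ ((k : ℝ) * α + d)) *
      (Real.Gamma (((j : ℝ) + k * α + d) / 2) /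
        Real.Gamma (((j : ℝ) - k * α) / 2))) : ℝ) : ℂ) * SHk d α Λ j k u

/-- The `k`-th term `((-2^α)^k π^{-d/2} / (k! r^{kα+1})) (Γ((kα+d)/2)/Γ(-kα/2)) ∫ V^k dω`
of the series for the density of `|X|`. -/
def radTerm (d : ℕ) (α : ℝ) (Λ : Measure (Sph d)) (k : ℕ) (r : ℝ) : ℂ :=
  ((((-((2 : ℝ) ^ α)) ^ k * Real.pi ^ (-(d : ℝ) / 2) /
      ((Nat.factorial k : ℝ) * r ^ ((k : ℝ) * α + 1)) *
      (Real.Gamma (((k : ℝ) * α + d) / 2) / Real.Gamma (-((k : ℝ) * α) / 2))) : ℝ) : ℂ) *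
    ∫ u, (Vfun d α Λ u) ^ k ∂(ωd d)

end StablePaper

namespace StablePaper

/-! ### Zonal harmonic polynomials -/

section Zonal

open MvPolynomial

variable {d : ℕ}

/-- The formal Laplacian. -/
def lap (p : MvPolynomial (Fin d) ℂ) : MvPolynomial (Fin d) ℂ :=
  ∑ i, pderiv i (pderiv i p)

/-- The formal inner product of two gradients. -/
def gradDot (p q : MvPolynomial (Fin d) ℂ) : MvPolynomial (Fin d) ℂ :=
  ∑ i, pderiv i p * pderiv i q

/-- The linear form `x ↦ ⟨u, x⟩`. -/
def linForm (u : Ed d) : MvPolynomial (Fin d) ℂ := ∑ i, C (u i : ℂ) * X i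

/-- The quadratic form `x ↦ |x|²`. -/
def sqForm (d : ℕ) : MvPolynomial (Fin d) ℂ := ∑ i, X i ^ 2

lemma C_two : (C 2 : MvPolynomial (Fin d) ℂ) = 2 := map_ofNat C 2

lemma lap_mul (p q : MvPolynomial (Fin d) ℂ) :
    lap (p * q) = lap p * q + 2 * gradDot p q + p * lap q := by
  simp only [lap, gradDot, pderiv_mul, map_add, Finset.sum_add_distrib, Finset.sum_mul,
    Finset.mul_sum, two_mul]
  ring

lemma lap_sub (p q : MvPolynomial (Fin d) ℂ) : lap (p - q) = lap p - lap q := by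
  simp [lap]

lemma lap_C_mul (c : ℂ) (p : MvPolynomial (Fin d) ℂ) : lap (C c * p) = C c * lap p := by
  simp [lap, Finset.mul_sum]

lemma lap_sum {ι : Type*} (s : Finset ι) (p : ι → MvPolynomial (Fin d) ℂ) :
    lap (∑ i ∈ s, p i) = ∑ i ∈ s, lap (p i) := by
  simp only [lap, map_sum]
  exact Finset.sum_comm

lemma pderiv_linForm (u : Ed d) (i : Fin d) : pderiv i (linForm u) = C (u i : ℂ) := by
  simp [linForm, pderiv_X, Pi.single_apply]

lemma pderiv_sqForm (i : Fin d) : pderiv i (sqForm d) = 2 * X i := by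
  simp [sqForm, pderiv_X, Pi.single_apply]

lemma isHomogeneous_linForm (u : Ed d) : (linForm u).IsHomogeneous 1 :=
  IsHomogeneous.sum _ _ _ fun i _ => isHomogeneous_C_mul_X _ i

lemma isHomogeneous_sqForm : (sqForm d).IsHomogeneous 2 :=
  IsHomogeneous.sum _ _ _ fun i _ => by simpa using (isHomogeneous_X ℂ i).pow 2

lemma sum_sq_sphere (u : Sph d) : ∑ i, ((u : Ed d) i : ℂ) * ((u : Ed d) i : ℂ) = 1 := by
  have h := EuclideanSpace.real_norm_sq_eq (u : Ed d)
  rw [norm_eq_of_mem_sphere] at h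
  exact_mod_cast (by simpa [sq] using h.symm)

lemma lap_linForm_pow (u : Sph d) (a : ℕ) :
    lap (linForm (u : Ed d) ^ a) = C ((a : ℂ) * (a - 1)) * linForm (u : Ed d) ^ (a - 2) := by
  have : ∀ i, pderiv i (pderiv i (linForm (u : Ed d) ^ a)) =
      C ((a : ℂ) * (a - 1)) * linForm (u : Ed d) ^ (a - 2) *
        C (((u : Ed d) i : ℂ) * ((u : Ed d) i : ℂ)) := by
    intro i
    rcases a with _ | a
    · simp
    · simp [pderiv_linForm]
      ring
  simp only [lap, this]
  rw [← Finset.mul_sum, ← map_sum, sum_sq_sphere, C_1, mul_one]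

lemma gradDot_linForm_pow (u : Ed d) (a m : ℕ) :
    gradDot (linForm u ^ a) (sqForm d ^ m) =
      C (2 * (a : ℂ) * m) * (linForm u ^ a * sqForm d ^ (m - 1)) := by
  have : ∀ i, pderiv i (linForm u ^ a) * pderiv i (sqForm d ^ m) =
      C (2 * (a : ℂ) * m) * linForm u ^ (a - 1) * sqForm d ^ (m - 1) * (C (u i : ℂ) * X i) := by
    intro i
    simp [pderiv_linForm, pderiv_sqForm, C_two]
    ring
  simp only [gradDot, this]
  rw [← Finset.mul_sum, ← linForm]
  rcases a with _ | a
  · simp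
  · rw [Nat.add_sub_cancel, pow_succ]
    ring

lemma gradDot_sqForm_left {p : MvPolynomial (Fin d) ℂ} {n : ℕ} (hp : p.IsHomogeneous n) :
    gradDot (sqForm d) p = C (2 * (n : ℂ)) * p := by
  simp only [gradDot, pderiv_sqForm, mul_assoc]
  rw [← Finset.mul_sum, hp.sum_X_mul_pderiv]
  simp [mul_assoc, C_two]

lemma lap_sqForm : lap (sqForm d) = C (2 * (d : ℂ)) := by
  simp only [lap, pderiv_sqForm, ← C_two, pderiv_C_mul, pderiv_X_self, mul_one]
  simp [mul_comm]

lemma lap_sqForm_pow (m : ℕ) :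
    lap (sqForm d ^ m) = C (2 * (m : ℂ) * (2 * m + d - 2)) * sqForm d ^ (m - 1) := by
  induction m with
  | zero => simp [lap]
  | succ m ih =>
    rw [pow_succ', lap_mul, ih, gradDot_sqForm_left (isHomogeneous_sqForm.pow m), lap_sqForm]
    rcases m with _ | m
    · simp
    · simp only [Nat.add_sub_cancel, pow_succ]
      simp [C_two]
      ring

lemma lap_zonal_monomial (u : Sph d) (a m : ℕ) :
    lap (linForm (u : Ed d) ^ a * sqForm d ^ m) =
      C ((a : ℂ) * (a - 1)) * (linForm (u : Ed d) ^ (a - 2) * sqForm d ^ m) +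
      C (2 * (m : ℂ) * (2 * a + 2 * m + d - 2)) *
        (linForm (u : Ed d) ^ a * sqForm d ^ (m - 1)) := by
  rw [lap_mul, lap_linForm_pow, gradDot_linForm_pow, lap_sqForm_pow]
  simp [C_two]
  ring

/-- A family of polynomials has continuous coefficients. -/
def ContCoeff {X : Type*} [TopologicalSpace X] (P : X → MvPolynomial (Fin d) ℂ) : Prop :=
  ∀ s, Continuous fun x => (P x).coeff s

namespace ContCoeff

variable {X : Type*} [TopologicalSpace X] {P Q : X → MvPolynomial (Fin d) ℂ}

lemma const (p : MvPolynomial (Fin d) ℂ) : ContCoeff fun _ : X => p :=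
  fun _ => continuous_const

lemma const_C {f : X → ℂ} (hf : Continuous f) :
    ContCoeff fun x => (C (f x) : MvPolynomial (Fin d) ℂ) := by
  intro s
  simp only [coeff_C]
  split_ifs <;> fun_prop

lemma mul (hP : ContCoeff P) (hQ : ContCoeff Q) : ContCoeff fun x => P x * Q x := by
  intro s
  simp only [coeff_mul]
  exact continuous_finsetSum _ fun a _ => (hP _).mul (hQ _)

lemma sub (hP : ContCoeff P) (hQ : ContCoeff Q) : ContCoeff fun x => P x - Q x := by
  intro s
  simp only [coeff_sub]
  exact (hP s).sub (hQ s)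

lemma sum {ι : Type*} (t : Finset ι) {P : ι → X → MvPolynomial (Fin d) ℂ}
    (hP : ∀ i, ContCoeff (P i)) : ContCoeff fun x => ∑ i ∈ t, P i x := by
  intro s
  simp only [coeff_sum]
  exact continuous_finsetSum _ fun i _ => hP i s

lemma pow (hP : ContCoeff P) (n : ℕ) : ContCoeff fun x => P x ^ n := by
  induction n with
  | zero => simpa using const 1
  | succ n ih => simpa only [pow_succ] using ih.mul hP

end ContCoeff

lemma contCoeff_linForm : ContCoeff fun u : Sph d => linForm (u : Ed d) :=
  ContCoeff.sum _ fun i => (ContCoeff.const_C (by fun_prop)).mul (ContCoeff.const _)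

/-- Evaluation of a complex polynomial at a real point. -/
def evalR (p : MvPolynomial (Fin d) ℂ) (x : Ed d) : ℂ :=
  MvPolynomial.eval (fun i => (x i : ℂ)) p

lemma evalR_linForm (u x : Ed d) : evalR (linForm u) x = (⟪u, x⟫ : ℝ) := by
  simp [evalR, linForm, PiLp.inner_apply, mul_comm]

lemma evalR_sqForm (x : Ed d) : evalR (sqForm d) x = (‖x‖ ^ 2 : ℝ) := by
  rw [EuclideanSpace.real_norm_sq_eq]
  simp [evalR, sqForm]

lemma lap_gegenbauer_sum (u : Sph d) (j : ℕ) (c : ℕ → ℂ)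
    (hc : ∀ m, 2 * (m + 1) ≤ j → c m * ((j - 2 * m : ℕ) * ((j - 2 * m : ℕ) - 1)) +
      c (m + 1) * (2 * (m + 1 : ℕ) * (2 * (j - 2 * (m + 1) : ℕ) + 2 * (m + 1 : ℕ) + d - 2)) = 0) :
    lap (∑ m ∈ Finset.range (j / 2 + 1),
      C (c m) * (linForm (u : Ed d) ^ (j - 2 * m) * sqForm d ^ m)) = 0 := by
  rw [lap_sum]
  simp only [lap_C_mul, lap_zonal_monomial, mul_add, Finset.sum_add_distrib]
  rw [Finset.sum_range_succ, Finset.sum_range_succ']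
  have h0 : ((j - 2 * (j / 2) : ℕ) : ℂ) * ((j - 2 * (j / 2) : ℕ) - 1) = 0 := by
    have : j - 2 * (j / 2) = 0 ∨ j - 2 * (j / 2) = 1 := by omega
    rcases this with h | h <;> simp [h]
  rw [h0]
  simp only [CharP.cast_eq_zero, map_zero, mul_zero, zero_mul, add_zero]
  rw [← Finset.sum_add_distrib]
  refine Finset.sum_eq_zero fun m hm => ?_
  have hm' : 2 * (m + 1) ≤ j := by
    have := Finset.mem_range.1 hm
    omega
  have h := hc m hm'
  rw [Nat.add_sub_cancel, show j - 2 * m - 2 = j - 2 * (m + 1) by omega, ← mul_assoc (C (c m)),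
    ← mul_assoc (C (c (m + 1))), ← add_mul, ← C_mul, ← C_mul, ← C_add, h]
  simp

lemma risingFactorial_succ (b : ℝ) (n : ℕ) :
    risingFactorial b (n + 1) = risingFactorial b n * (b + n) :=
  Finset.prod_range_succ _ _

/-- Coefficients of the Gegenbauer polynomial. -/
def gegCoeff (b : ℝ) (j m : ℕ) : ℝ :=
  (-1 : ℝ) ^ m * 2 ^ (j - 2 * m) * risingFactorial b (j - m) /
      ((Nat.factorial m : ℝ) * (Nat.factorial (j - 2 * m) : ℝ))

lemma gegCoeff_rec (d j m : ℕ) (hm : 2 * (m + 1) ≤ j) :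
    gegCoeff (((d : ℝ) - 2) / 2) j m * ((j - 2 * m : ℕ) * ((j - 2 * m : ℕ) - 1)) +
      gegCoeff (((d : ℝ) - 2) / 2) j (m + 1) *
        (2 * (m + 1 : ℕ) * (2 * (j - 2 * (m + 1) : ℕ) + 2 * (m + 1 : ℕ) + d - 2)) = 0 := by
  obtain ⟨n, rfl⟩ : ∃ n, j = 2 * (m + 1) + n := ⟨j - 2 * (m + 1), by omega⟩
  unfold gegCoeff
  rw [show 2 * (m + 1) + n - 2 * m = n + 2 by omega,
    show 2 * (m + 1) + n - 2 * (m + 1) = n by omega,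
    show 2 * (m + 1) + n - m = (m + n + 1) + 1 by omega,
    show 2 * (m + 1) + n - (m + 1) = m + n + 1 by omega, risingFactorial_succ,
    Nat.factorial_succ (n + 1), Nat.factorial_succ n, Nat.factorial_succ m]
  push_cast
  field_simp
  ring

/-- There is a harmonic homogeneous polynomial of degree `j`, depending continuously on `u`,
whose restriction to the sphere is `v ↦ C̃_j(⟨u, v⟩)`. -/
structure IsZonal (d j : ℕ) (Z : Sph d → MvPolynomial (Fin d) ℂ) (f : ℝ → ℝ) : Prop where
  homog : ∀ u, (Z u).IsHomogeneous j
  harm : ∀ u, lap (Z u) = 0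
  cont : ContCoeff Z
  eval_eq : ∀ u v : Sph d, evalR (Z u) v = (f ⟪(u : Ed d), (v : Ed d)⟫ : ℝ)

lemma isZonal_gegenbauer (d j : ℕ) (q : ℝ) :
    ∃ Z, IsZonal d j Z fun t => gegenbauer (((d : ℝ) - 2) / 2) j t / q := by
  set c : ℕ → ℂ := fun m => (gegCoeff (((d : ℝ) - 2) / 2) j m / q : ℝ) with hc
  refine ⟨fun u => ∑ m ∈ Finset.range (j / 2 + 1),
      C (c m) * (linForm (u : Ed d) ^ (j - 2 * m) * sqForm d ^ m), ?_, ?_, ?_, ?_⟩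
  · refine fun u => IsHomogeneous.sum _ _ _ fun m hm => ?_
    have := Finset.mem_range.1 hm
    have h := ((isHomogeneous_linForm (u : Ed d)).pow (j - 2 * m)).mul
      ((isHomogeneous_sqForm (d := d)).pow m)
    rw [show 1 * (j - 2 * m) + 2 * m = j by omega] at h
    exact h.C_mul _
  · refine fun u => lap_gegenbauer_sum u j c fun m hm => ?_
    have h := congrArg (fun x : ℝ => ((x / q : ℝ) : ℂ)) (gegCoeff_rec d j m hm)
    simp only [zero_div, Complex.ofReal_zero] at h
    rw [← h, hc]
    push_cast
    ring
  · exact ContCoeff.sum _ fun m => (ContCoeff.const _).mul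
      ((contCoeff_linForm.pow _).mul (ContCoeff.const _))
  · intro u v
    have h1 := evalR_linForm (u : Ed d) (v : Ed d)
    have h2 := evalR_sqForm (v : Ed d)
    simp only [evalR, norm_eq_of_mem_sphere] at h1 h2
    simp only [evalR, map_sum, map_mul, map_pow, h1, h2, eval_C, hc, gegenbauer, gegCoeff,
      Finset.sum_div]
    push_cast
    refine Finset.sum_congr rfl fun m _ => ?_
    ring

/-- The homogenized Chebyshev polynomials. -/
def chebForm (u : Ed d) : ℕ → MvPolynomial (Fin d) ℂ
  | 0 => 1
  | 1 => linForm u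
  | n + 2 => 2 * linForm u * chebForm u (n + 1) - sqForm d * chebForm u n

lemma isHomogeneous_chebForm (u : Ed d) (n : ℕ) :
    (chebForm u n).IsHomogeneous n ∧ (chebForm u (n + 1)).IsHomogeneous (n + 1) := by
  induction n with
  | zero => exact ⟨isHomogeneous_one _ _, isHomogeneous_linForm u⟩
  | succ n ih =>
    refine ⟨ih.2, IsHomogeneous.sub ?_ ?_⟩
    · have := (((isHomogeneous_C (Fin d) (2 : ℂ)).mul (isHomogeneous_linForm u)).mul ih.2)
      rw [show 0 + 1 + (n + 1) = n + 1 + 1 by omega] at this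
      rwa [C_two] at this
    · have := (isHomogeneous_sqForm (d := d)).mul ih.1
      rwa [add_comm] at this

lemma contCoeff_chebForm (n : ℕ) : ContCoeff (fun u : Sph d => chebForm (u : Ed d) n) ∧
    ContCoeff fun u : Sph d => chebForm (u : Ed d) (n + 1) := by
  induction n with
  | zero => exact ⟨ContCoeff.const 1, contCoeff_linForm⟩
  | succ n ih =>
    exact ⟨ih.2, (((ContCoeff.const 2).mul contCoeff_linForm).mul ih.2).sub
      ((ContCoeff.const _).mul ih.1)⟩

lemma evalR_chebForm (u v : Sph d) (n : ℕ) :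
    evalR (chebForm (u : Ed d) n) v =
      ((Polynomial.Chebyshev.T ℝ n).eval ⟪(u : Ed d), (v : Ed d)⟫ : ℝ) ∧
    evalR (chebForm (u : Ed d) (n + 1)) v =
      ((Polynomial.Chebyshev.T ℝ (n + 1 : ℕ)).eval ⟪(u : Ed d), (v : Ed d)⟫ : ℝ) := by
  induction n with
  | zero => exact ⟨by simp [chebForm, evalR], by simpa [chebForm] using evalR_linForm _ _⟩
  | succ n ih =>
    refine ⟨ih.2, ?_⟩
    have h1 := evalR_linForm (u : Ed d) (v : Ed d)
    have h2 := evalR_sqForm (v : Ed d)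
    have h3 := Polynomial.Chebyshev.T_add_two ℝ n
    obtain ⟨i1, i2⟩ := ih
    simp only [evalR, norm_eq_of_mem_sphere] at h1 h2 i1 i2 ⊢
    rw [show ((n + 1 + 1 : ℕ) : ℤ) = n + 2 by push_cast; ring, h3]
    push_cast at i2
    simp [chebForm, h1, h2, i1, i2]

lemma gradDot_mul (p q r : MvPolynomial (Fin d) ℂ) :
    gradDot r (p * q) = gradDot r p * q + p * gradDot r q := by
  simp only [gradDot, Finset.sum_mul, Finset.mul_sum, ← Finset.sum_add_distrib, pderiv_mul]
  exact Finset.sum_congr rfl fun i _ => by ring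

lemma gradDot_sub (p q r : MvPolynomial (Fin d) ℂ) :
    gradDot r (p - q) = gradDot r p - gradDot r q := by
  simp only [gradDot, map_sub, mul_sub, Finset.sum_sub_distrib]

lemma gradDot_linForm_chebForm (u : Sph d) (n : ℕ) :
    gradDot (linForm (u : Ed d)) (chebForm (u : Ed d) (n + 1)) =
      (n + 1 : ℕ) * chebForm (u : Ed d) n ∧
    gradDot (linForm (u : Ed d)) (chebForm (u : Ed d) (n + 2)) =
      (n + 2 : ℕ) * chebForm (u : Ed d) (n + 1) := by
  have hL : gradDot (linForm (u : Ed d)) (linForm (u : Ed d)) = 1 := by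
    simp only [gradDot, pderiv_linForm, ← C_mul, ← map_sum, sum_sq_sphere, C_1]
  have hR : gradDot (linForm (u : Ed d)) (sqForm d) = 2 * linForm (u : Ed d) := by
    simp only [gradDot, pderiv_linForm, pderiv_sqForm]
    simp only [linForm, Finset.mul_sum]
    exact Finset.sum_congr rfl fun i _ => by ring
  have hC : gradDot (linForm (u : Ed d)) 2 = 0 := by
    rw [← C_two]
    simp only [gradDot, pderiv_C, mul_zero, Finset.sum_const_zero]
  have h1 : gradDot (linForm (u : Ed d)) (1 : MvPolynomial (Fin d) ℂ) = 0 := by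
    simp [gradDot]
  induction n with
  | zero =>
    simp only [chebForm, gradDot_sub, gradDot_mul, hL, hR, hC, h1]
    push_cast
    constructor <;> ring
  | succ n ih =>
    refine ⟨ih.2, ?_⟩
    rw [show n + 1 + 2 = n + 3 by omega]
    have e : chebForm (u : Ed d) (n + 3) = 2 * linForm (u : Ed d) * chebForm (u : Ed d) (n + 2) -
      sqForm d * chebForm (u : Ed d) (n + 1) := rfl
    rw [e, gradDot_sub, gradDot_mul, gradDot_mul, gradDot_mul, hL, hR, hC, ih.2, ih.1]
    have e2 : chebForm (u : Ed d) (n + 1 + 1) =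
      2 * linForm (u : Ed d) * chebForm (u : Ed d) (n + 1) -
      sqForm d * chebForm (u : Ed d) n := rfl
    rw [show n + 2 = n + 1 + 1 by omega, e2]
    push_cast
    ring

lemma lap_chebForm (u : Sph 2) (n : ℕ) :
    lap (chebForm (u : Ed 2) n) = 0 ∧ lap (chebForm (u : Ed 2) (n + 1)) = 0 := by
  have hL : lap (linForm (u : Ed 2)) = 0 := by
    simp [lap, pderiv_linForm]
  induction n with
  | zero => exact ⟨by simp [chebForm, lap], hL⟩
  | succ n ih =>
    refine ⟨ih.2, ?_⟩
    have e : chebForm (u : Ed 2) (n + 1 + 1) =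
      C 2 * (linForm (u : Ed 2) * chebForm (u : Ed 2) (n + 1)) -
      sqForm 2 * chebForm (u : Ed 2) n := by
      simp [chebForm, mul_assoc, C_two]
    rw [e, lap_sub, lap_C_mul, lap_mul, lap_mul, hL, ih.1, ih.2,
      (gradDot_linForm_chebForm u n).1, lap_sqForm,
      gradDot_sqForm_left (isHomogeneous_chebForm _ n).1]
    simp [C_two]
    ring

lemma exists_isZonal (d j : ℕ) : ∃ Z, IsZonal d j Z (gegenbauerN (((d : ℝ) - 2) / 2) j) := by
  by_cases hb : ((d : ℝ) - 2) / 2 = 0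
  · have hd : d = 2 := by
      have : (d : ℝ) = 2 := by linarith
      exact_mod_cast this
    subst hd
    refine ⟨fun u => chebForm (u : Ed 2) j, fun u => (isHomogeneous_chebForm _ j).1,
      fun u => (lap_chebForm u j).1, (contCoeff_chebForm j).1, fun u v => ?_⟩
    simpa [gegenbauerN] using (evalR_chebForm u v j).1
  · obtain ⟨Z, hZ⟩ := isZonal_gegenbauer d j (gegenbauer (((d : ℝ) - 2) / 2) j 1)
    refine ⟨Z, hZ.homog, hZ.harm, hZ.cont, fun u v => ?_⟩
    simpa [gegenbauerN, hb] using hZ.eval_eq u v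

end Zonal

/-! ### Polar coordinates -/

section Polar

variable {d : ℕ}

instance : IsFiniteMeasure (ωd d) := by unfold ωd; infer_instance

lemma integral_volumeIoiPow (n : ℕ) (f : ℝ → ℂ) :
    ∫ x : Set.Ioi (0 : ℝ), f x ∂(Measure.volumeIoiPow n) =
      ∫ ρ in Set.Ioi (0 : ℝ), (ρ ^ n : ℝ) * f ρ := by
  simp only [Measure.volumeIoiPow, ENNReal.ofReal]
  rw [integral_withDensity_eq_integral_smul,
    integral_subtype_comap measurableSet_Ioi fun a ↦ Real.toNNReal (a ^ n) • f a,
    setIntegral_congr_fun measurableSet_Ioi fun x hx ↦ ?_]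
  · rw [NNReal.smul_def, Real.coe_toNNReal _ (pow_nonneg hx.out.le _), Complex.real_smul]
  · exact (measurable_subtype_coe.pow_const _).real_toNNReal

/-- Integration in polar coordinates. -/
lemma integral_polar (hd : 0 < d) {F : Ed d → ℂ} (hF : Integrable F) :
    ∫ z, F z = ∫ w, (∫ ρ in Set.Ioi (0 : ℝ), (ρ ^ (d - 1) : ℝ) * F (ρ • (w : Ed d))) ∂(ωd d) := by
  have : NeZero d := ⟨hd.ne'⟩
  have hmp := (volume : Measure (Ed d)).measurePreserving_homeomorphUnitSphereProd
  rw [finrank_euclideanSpace_fin] at hmp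
  set H : Sph d × Set.Ioi (0 : ℝ) → ℂ := fun p => F ((p.2 : ℝ) • (p.1 : Ed d)) with hH
  have hcomp : ∀ z : ({0}ᶜ : Set (Ed d)), H (homeomorphUnitSphereProd (Ed d) z) = F z := by
    intro z
    have hz : ‖(z : Ed d)‖ ≠ 0 := norm_ne_zero_iff.2 z.2
    simp [hH, homeomorphUnitSphereProd, smul_smul, hz]
  have hint : Integrable H ((ωd d).prod (Measure.volumeIoiPow (d - 1))) := by
    have := hmp.integrable_comp_emb (g := H) (Homeomorph.measurableEmbedding _)
    rw [ωd, ← this]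
    simp only [Function.comp_def, hcomp]
    have h2 := integrableOn_iff_comap_subtypeVal (μ := (volume : Measure (Ed d))) (f := F)
      (s := {0}ᶜ) (measurableSet_singleton _).compl
    exact h2.1 hF.integrableOn
  calc ∫ z, F z = ∫ x : ({(0)}ᶜ : Set (Ed d)), F x.1 ∂(Measure.comap
        (Subtype.val : ({0}ᶜ : Set (Ed d)) → Ed d) volume) := by
        rw [integral_subtype_comap (measurableSet_singleton _).compl F,
          restrict_compl_singleton]
    _ = ∫ p, H p ∂((ωd d).prod (Measure.volumeIoiPow (d - 1))) := by
        rw [ωd, ← hmp.integral_comp (Homeomorph.measurableEmbedding _) H]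
        simp only [hcomp]
    _ = _ := by
        rw [integral_prod _ hint]
        refine integral_congr_ae (Eventually.of_forall fun w => ?_)
        exact integral_volumeIoiPow (d - 1) fun ρ => F (ρ • (w : Ed d))

end Polar

/-! ### Gaussian moments of polynomials -/

section Gauss

open MvPolynomial

variable {d : ℕ}

lemma integrable_pow_mul_gauss (n : ℕ) :
    Integrable fun x : ℝ => x ^ n * Real.exp (-(1 / 2) * x ^ 2) := by
  have := integrable_rpow_mul_exp_neg_mul_sq (b := 1 / 2) (by norm_num) (s := n)
    (by linarith [n.cast_nonneg (α := ℝ)])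
  simpa using this

/-- One-dimensional Gaussian moments. -/
def gMom (n : ℕ) : ℝ := ∫ x : ℝ, x ^ n * Real.exp (-(1 / 2) * x ^ 2)

lemma gMom_succ (n : ℕ) : gMom (n + 1) = n * gMom (n - 1) := by
  have hder : ∀ x : ℝ, HasDerivAt (fun x : ℝ => x ^ n * Real.exp (-(1 / 2) * x ^ 2))
      (n * (x ^ (n - 1) * Real.exp (-(1 / 2) * x ^ 2)) -
        x ^ (n + 1) * Real.exp (-(1 / 2) * x ^ 2)) x := by
    intro x
    have h2 : HasDerivAt (fun x : ℝ => Real.exp (-(1 / 2) * x ^ 2))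
        (Real.exp (-(1 / 2) * x ^ 2) * (-(1 / 2) * (2 * x))) x := by
      have := ((hasDerivAt_pow 2 x).const_mul (-(1 / 2) : ℝ)).exp
      simpa using this
    refine ((hasDerivAt_pow n x).mul h2).congr_deriv ?_
    ring
  have hi1 := (integrable_pow_mul_gauss (n - 1)).const_mul (n : ℝ)
  have hi2 := integrable_pow_mul_gauss (n + 1)
  have := integral_eq_zero_of_hasDerivAt_of_integrable hder (hi1.sub hi2)
    (integrable_pow_mul_gauss n)
  rw [integral_sub hi1 hi2, integral_const_mul] at this
  unfold gMom
  linarith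

/-- The Gaussian weight. -/
def gaussW (x : Ed d) : ℝ := Real.exp (-(1 / 2) * ‖x‖ ^ 2)

lemma evalR_monomial_mul_gaussW (s : Fin d →₀ ℕ) (a : ℂ) (x : Ed d) :
    evalR (monomial s a) x * gaussW x =
      a * ((∏ i, (x i ^ s i * Real.exp (-(1 / 2) * x i ^ 2)) : ℝ) : ℂ) := by
  have h : gaussW x = ∏ i, Real.exp (-(1 / 2) * x i ^ 2) := by
    rw [gaussW, EuclideanSpace.real_norm_sq_eq, ← Real.exp_sum, Finset.mul_sum]
  rw [h, Finset.prod_mul_distrib, evalR, eval_monomial, Finsupp.prod_fintype _ _ (by simp)]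
  push_cast
  ring

lemma integrable_monomial_gauss (s : Fin d →₀ ℕ) (a : ℂ) :
    Integrable fun x : Ed d => evalR (monomial s a) x * gaussW x := by
  simp only [evalR_monomial_mul_gaussW]
  refine Integrable.const_mul (Integrable.ofReal ?_) _
  have h := Integrable.fintype_prod (μ := fun _ : Fin d => (volume : Measure ℝ))
    (f := fun i x => x ^ s i * Real.exp (-(1 / 2) * x ^ 2))
    (fun i => integrable_pow_mul_gauss (s i))
  exact ((EuclideanSpace.volume_preserving_symm_measurableEquiv_toLp (Fin d)).integrable_comp_emb
    (MeasurableEquiv.measurableEmbedding _)).2 h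

/-- The Gaussian integral of a polynomial. -/
def gaussE (p : MvPolynomial (Fin d) ℂ) : ℂ := ∫ x : Ed d, evalR p x * gaussW x

lemma gaussE_monomial (s : Fin d →₀ ℕ) (a : ℂ) :
    gaussE (monomial s a) = a * ((∏ i, gMom (s i) : ℝ) : ℂ) := by
  simp only [gaussE, evalR_monomial_mul_gaussW]
  rw [integral_const_mul, integral_complex_ofReal]
  congr 2
  have h1 := (EuclideanSpace.volume_preserving_symm_measurableEquiv_toLp (Fin d)).integral_comp
    (MeasurableEquiv.measurableEmbedding _)
    (fun x : Fin d → ℝ => ∏ i, (x i ^ s i * Real.exp (-(1 / 2) * x i ^ 2)))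
  have h2 := integral_fintype_prod_volume_eq_prod
    (fun (i : Fin d) (x : ℝ) => x ^ s i * Real.exp (-(1 / 2) * x ^ 2))
  exact h1.trans h2

lemma integrable_gauss (p : MvPolynomial (Fin d) ℂ) :
    Integrable fun x : Ed d => evalR p x * gaussW x := by
  induction p using MvPolynomial.induction_on' with
  | monomial s a => exact integrable_monomial_gauss s a
  | add p q hp hq =>
    exact (hp.add hq).congr (Eventually.of_forall fun x => by simp [evalR, add_mul])

lemma gaussE_add (p q : MvPolynomial (Fin d) ℂ) : gaussE (p + q) = gaussE p + gaussE q := by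
  simp only [gaussE]
  rw [← integral_add (integrable_gauss p) (integrable_gauss q)]
  simp [evalR, add_mul]

lemma gaussE_C_mul (c : ℂ) (p : MvPolynomial (Fin d) ℂ) : gaussE (C c * p) = c * gaussE p := by
  simp only [gaussE]
  rw [← integral_const_mul]
  simp [evalR, mul_assoc]

lemma gaussE_sum {ι : Type*} (t : Finset ι) (p : ι → MvPolynomial (Fin d) ℂ) :
    gaussE (∑ i ∈ t, p i) = ∑ i ∈ t, gaussE (p i) := by
  classical
  induction t using Finset.induction_on with
  | empty => simp [gaussE, evalR]
  | insert a t ha ih => rw [Finset.sum_insert ha, Finset.sum_insert ha, gaussE_add, ih]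

/-- Gaussian integration by parts. -/
lemma gaussE_X_mul (i : Fin d) (p : MvPolynomial (Fin d) ℂ) :
    gaussE (X i * p) = gaussE (pderiv i p) := by
  induction p using MvPolynomial.induction_on' with
  | monomial s a =>
    rw [pderiv_monomial, X, monomial_mul, gaussE_monomial, gaussE_monomial,
      ← Finset.mul_prod_erase _ _ (Finset.mem_univ i), ← Finset.mul_prod_erase _ _
      (Finset.mem_univ i)]
    have h : ∀ k ∈ Finset.univ.erase i,
        gMom ((Finsupp.single i 1 + s : Fin d →₀ ℕ) k) =
          gMom ((s - Finsupp.single i 1 : Fin d →₀ ℕ) k) := by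
      intro k hk
      have : i ≠ k := (Finset.ne_of_mem_erase hk).symm
      simp [this]
    rw [Finset.prod_congr rfl h]
    have h2 : (Finsupp.single i 1 + s : Fin d →₀ ℕ) i = s i + 1 := by simp [add_comm]
    have h3 : (s - Finsupp.single i 1 : Fin d →₀ ℕ) i = s i - 1 := by simp
    rw [h2, h3, gMom_succ]
    push_cast
    ring
  | add p q hp hq => rw [mul_add, map_add, gaussE_add, gaussE_add, hp, hq]

lemma gaussE_eq_zero {p : MvPolynomial (Fin d) ℂ} {n : ℕ} (hn : n ≠ 0) (hp : p.IsHomogeneous n)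
    (hl : lap p = 0) : gaussE p = 0 := by
  have h : gaussE (∑ i, X i * pderiv i p) = gaussE (lap p) := by
    rw [lap, gaussE_sum, gaussE_sum]
    exact Finset.sum_congr rfl fun i _ => gaussE_X_mul i _
  rw [hp.sum_X_mul_pderiv, hl, nsmul_eq_mul, ← map_natCast (C (σ := Fin d) (R := ℂ)),
    gaussE_C_mul] at h
  have h0 : gaussE (0 : MvPolynomial (Fin d) ℂ) = 0 := by simp [gaussE, evalR]
  rw [h0] at h
  exact (mul_eq_zero.1 h).resolve_left (by exact_mod_cast hn)

lemma pderiv_comm (i k : Fin d) (p : MvPolynomial (Fin d) ℂ) :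
    pderiv i (pderiv k p) = pderiv k (pderiv i p) := by
  have h : ⁅(pderiv i : Derivation ℂ (MvPolynomial (Fin d) ℂ) (MvPolynomial (Fin d) ℂ)),
      (pderiv k : Derivation ℂ (MvPolynomial (Fin d) ℂ) (MvPolynomial (Fin d) ℂ))⁆ = 0 := by
    refine MvPolynomial.derivation_ext fun l => ?_
    rw [Derivation.commutator_apply]
    simp only [pderiv_X, Derivation.zero_apply, Pi.single_apply]
    split_ifs <;> simp
  have := congrArg (fun D => D p) h
  rw [Derivation.commutator_apply] at this
  exact sub_eq_zero.1 this

/-- The derivative in direction `w` preserves harmonicity. -/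
lemma lap_gradDot_linForm (w : Ed d) {p : MvPolynomial (Fin d) ℂ} (hl : lap p = 0) :
    lap (gradDot (linForm w) p) = 0 := by
  have hcomm : ∀ i, lap (pderiv i p) = pderiv i (lap p) := by
    intro i
    simp only [lap, map_sum]
    refine Finset.sum_congr rfl fun k _ => ?_
    rw [pderiv_comm i k, pderiv_comm i k p]
  simp only [gradDot, pderiv_linForm]
  rw [lap_sum]
  simp [lap_C_mul, hcomm, hl]

lemma evalR_gradDot_linForm (w : Ed d) {p : MvPolynomial (Fin d) ℂ} {j : ℕ}
    (hp : p.IsHomogeneous j) : evalR (gradDot (linForm w) p) w = j * evalR p w := by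
  have := congrArg (fun q => evalR q w) hp.sum_X_mul_pderiv
  simpa [evalR, gradDot, pderiv_linForm] using this

lemma gaussE_mul_linForm_pow_succ (w : Sph d) (p : MvPolynomial (Fin d) ℂ) (n : ℕ) :
    gaussE (p * linForm (w : Ed d) ^ (n + 1)) =
      gaussE (gradDot (linForm (w : Ed d)) p * linForm (w : Ed d) ^ n) +
        n * gaussE (p * linForm (w : Ed d) ^ (n - 1)) := by
  have h1 : p * linForm (w : Ed d) ^ (n + 1) =
      ∑ i, C ((w : Ed d) i : ℂ) * (X i * (p * linForm (w : Ed d) ^ n)) := by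
    have : linForm (w : Ed d) = ∑ i, C ((w : Ed d) i : ℂ) * X i := rfl
    rw [pow_succ, ← mul_assoc]
    nth_rewrite 2 [this]
    rw [Finset.mul_sum]
    exact Finset.sum_congr rfl fun i _ => by ring
  have h2 : ∑ i, C ((w : Ed d) i : ℂ) * pderiv i (p * linForm (w : Ed d) ^ n) =
      gradDot (linForm (w : Ed d)) p * linForm (w : Ed d) ^ n +
        C (n : ℂ) * (p * linForm (w : Ed d) ^ (n - 1)) := by
    have : ∀ i, C ((w : Ed d) i : ℂ) * pderiv i (p * linForm (w : Ed d) ^ n) =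
        C ((w : Ed d) i : ℂ) * pderiv i p * linForm (w : Ed d) ^ n +
        C (n : ℂ) * (p * linForm (w : Ed d) ^ (n - 1)) *
          C (((w : Ed d) i : ℂ) * ((w : Ed d) i : ℂ)) := by
      intro i
      simp [pderiv_linForm]
      ring
    simp only [this, Finset.sum_add_distrib]
    rw [← Finset.sum_mul, ← Finset.mul_sum, ← map_sum, sum_sq_sphere, C_1, mul_one]
    simp only [gradDot, pderiv_linForm]
  rw [h1, gaussE_sum]
  simp only [gaussE_C_mul, gaussE_X_mul]
  simp only [← gaussE_C_mul]
  rw [← gaussE_sum, h2, gaussE_add]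

/-- The combinatorial factor in the Gaussian moments of a harmonic polynomial. -/
def momFac : ℕ → ℕ → ℂ
  | 0, 0 => 1
  | 0, _ + 1 => 0
  | 1, j => j * momFac 0 (j - 1)
  | n + 2, j => j * momFac (n + 1) (j - 1) + (n + 1) * momFac n j

lemma gaussE_harmonic (w : Sph d) (n : ℕ) : ∀ (j : ℕ) (p : MvPolynomial (Fin d) ℂ),
    p.IsHomogeneous j → lap p = 0 → gaussE (p * linForm (w : Ed d) ^ n) =
      gaussE (1 : MvPolynomial (Fin d) ℂ) * momFac n j * evalR p w := by
  have hgrad : ∀ (j : ℕ) (p : MvPolynomial (Fin d) ℂ), p.IsHomogeneous j →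
      (gradDot (linForm (w : Ed d)) p).IsHomogeneous (j - 1) := by
    intro j p hp
    simp only [gradDot, pderiv_linForm]
    exact IsHomogeneous.sum _ _ _ fun i _ => hp.pderiv.C_mul _
  induction n using Nat.strong_induction_on with
  | _ n ih =>
    intro j p hp hl
    match n with
    | 0 =>
      rcases j with _ | j
      · rw [← totalDegree_zero_iff_isHomogeneous, totalDegree_eq_zero_iff_eq_C] at hp
        rw [hp, pow_zero, gaussE_C_mul]
        simp [momFac, evalR, mul_comm]
      · rw [pow_zero, mul_one, gaussE_eq_zero j.succ_ne_zero hp hl]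
        simp [momFac]
    | 1 =>
      rw [gaussE_mul_linForm_pow_succ, ih 0 (by omega) (j - 1) _ (hgrad j p hp)
        (lap_gradDot_linForm _ hl), evalR_gradDot_linForm _ hp]
      simp [momFac]
      ring
    | n + 2 =>
      rw [gaussE_mul_linForm_pow_succ, ih (n + 1) (by omega) (j - 1) _ (hgrad j p hp)
        (lap_gradDot_linForm _ hl), evalR_gradDot_linForm _ hp, Nat.add_sub_cancel,
        ih n (by omega) j p hp hl]
      simp [momFac]
      ring

lemma momFac_eq_zero_of_odd (n : ℕ) : ∀ j, ¬ Even (n + j) → momFac n j = 0 := by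
  induction n using Nat.strong_induction_on with
  | _ n ih =>
    intro j h
    match n, j with
    | 0, 0 => simp at h
    | 0, j + 1 => simp [momFac]
    | 1, 0 => simp [momFac]
    | 1, j + 1 =>
      rw [momFac, ih 0 (by omega) _ (by
        simp only [Nat.add_sub_cancel]; intro h'; exact h (by
          rw [show 1 + (j + 1) = 0 + j + 2 by omega]; exact h'.add even_two)), mul_zero]
    | n + 2, 0 =>
      rw [momFac, ih n (by omega) 0 (fun h' => h (by
        rw [show n + 2 + 0 = n + 0 + 2 by omega]; exact h'.add even_two))]
      simp
    | n + 2, j + 1 =>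
      rw [momFac, ih n (by omega) (j + 1) (fun h' => h (by
        rw [show n + 2 + (j + 1) = n + (j + 1) + 2 by omega]; exact h'.add even_two)),
        ih (n + 1) (by omega) _ (fun h' => h (by
        rw [show n + 2 + (j + 1) = n + 1 + (j + 1 - 1) + 2 by omega]; exact h'.add even_two))]
      simp

lemma momFac_eq_zero_of_lt (n : ℕ) : ∀ j, n < j → momFac n j = 0 := by
  induction n using Nat.strong_induction_on with
  | _ n ih =>
    intro j h
    match n, j with
    | 0, j + 1 => simp [momFac]
    | 1, j + 1 => rw [momFac, ih 0 (by omega) _ (by omega), mul_zero]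
    | n + 2, j =>
      rw [momFac, ih n (by omega) j (by omega), ih (n + 1) (by omega) _ (by omega)]
      simp

lemma momFac_eq (n : ℕ) : ∀ j m, n = j + 2 * m →
    momFac n j = (n.factorial : ℂ) / (2 ^ m * m.factorial) := by
  induction n using Nat.strong_induction_on with
  | _ n ih =>
    intro j m h
    match n with
    | 0 =>
      obtain rfl : j = 0 := by omega
      obtain rfl : m = 0 := by omega
      simp [momFac]
    | 1 =>
      obtain rfl : j = 1 := by omega
      obtain rfl : m = 0 := by omega
      simp [momFac]
    | n + 2 =>
      rw [momFac]
      have e1 : (j : ℂ) * momFac (n + 1) (j - 1) =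
          j * ((n + 1).factorial / (2 ^ m * m.factorial)) := by
        rcases j with _ | j
        · simp
        · rw [ih (n + 1) (by omega) (j + 1 - 1) m (by omega)]
      have e2 : momFac n j = 2 * m * (n.factorial / (2 ^ m * m.factorial)) := by
        rcases m with _ | m
        · rw [momFac_eq_zero_of_lt n j (by omega)]
          simp
        · rw [ih n (by omega) j m (by omega), Nat.factorial_succ]
          push_cast
          field_simp
          ring
      have e3 : (n : ℂ) + 2 = j + 2 * m := by exact_mod_cast h
      rw [e1, e2, Nat.factorial_succ (n + 1), Nat.factorial_succ n]
      push_cast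
      have e4 : (j : ℂ) = n + 2 - 2 * m := by rw [e3]; ring
      rw [e4]
      field_simp
      ring

lemma evalR_smul {p : MvPolynomial (Fin d) ℂ} {n : ℕ} (hp : p.IsHomogeneous n) (ρ : ℝ) (x : Ed d) :
    evalR p (ρ • x) = (ρ : ℂ) ^ n * evalR p x := by
  simp only [evalR, eval_eq', Finset.mul_sum]
  refine Finset.sum_congr rfl fun s hs => ?_
  have h : ∑ i, s i = n := by
    have := hp (mem_support_iff.1 hs)
    rw [Finsupp.weight_apply, Finsupp.sum_fintype _ _ (by simp)] at this
    simpa using this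
  simp only [PiLp.smul_apply, smul_eq_mul, Complex.ofReal_mul, mul_pow, Finset.prod_mul_distrib,
    Finset.prod_pow_eq_pow_sum, h]
  ring

/-- `∫_0^∞ ρ^{n+d-1} e^{-ρ²/2} dρ`. -/
lemma integral_pow_gauss (n : ℕ) :
    ∫ ρ in Set.Ioi (0 : ℝ), ρ ^ n * Real.exp (-(1 / 2) * ρ ^ 2) =
      2 ^ (((n : ℝ) + 1) / 2) * (1 / 2) * Real.Gamma (((n : ℝ) + 1) / 2) := by
  have h := integral_rpow_mul_exp_neg_mul_rpow (p := 2) (q := n) (b := 1 / 2) (by norm_num)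
    (by linarith [n.cast_nonneg (α := ℝ)]) (by norm_num)
  rw [show (2 : ℝ) ^ (((n : ℝ) + 1) / 2) = (1 / 2) ^ (-((n : ℝ) + 1) / 2) by
    rw [one_div, Real.inv_rpow (by norm_num), ← Real.rpow_neg (by norm_num)]; ring_nf, ← h]
  simp

lemma gaussE_eq_sphere (hd : 0 < d) {p : MvPolynomial (Fin d) ℂ} {n : ℕ} (hp : p.IsHomogeneous n) :
    gaussE p = (∫ w : Sph d, evalR p w ∂(ωd d)) *
      ((2 ^ (((n : ℝ) + d) / 2) * (1 / 2) * Real.Gamma (((n : ℝ) + d) / 2) : ℝ) : ℂ) := by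
  rw [gaussE, integral_polar hd (integrable_gauss p), ← integral_mul_const]
  refine integral_congr_ae (Eventually.of_forall fun w => ?_)
  have h := integral_pow_gauss (n + d - 1)
  rw [show ((n + d - 1 : ℕ) : ℝ) + 1 = n + d by
    rw [Nat.cast_sub (by omega)]; push_cast; ring] at h
  simp only [← h, ← integral_complex_ofReal, ← integral_const_mul]
  refine setIntegral_congr_fun measurableSet_Ioi fun ρ hρ => ?_
  have hρ' : 0 < ρ := hρ
  simp only [evalR_smul hp, gaussW, norm_smul, norm_eq_of_mem_sphere, Real.norm_eq_abs,
    abs_of_pos hρ', mul_one]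
  rw [show n + d - 1 = n + (d - 1) by omega, pow_add]
  push_cast
  ring

lemma gaussE_one : gaussE (1 : MvPolynomial (Fin d) ℂ) = ((2 * π) ^ ((d : ℝ) / 2) : ℝ) := by
  have h0 : gMom 0 = (2 * π) ^ (1 / 2 : ℝ) := by
    simp only [gMom, pow_zero, one_mul]
    rw [integral_gaussian, Real.sqrt_eq_rpow]
    congr 1
    ring
  rw [show (1 : MvPolynomial (Fin d) ℂ) = monomial 0 1 from rfl, gaussE_monomial]
  simp only [Finsupp.coe_zero, Pi.zero_apply, h0, Finset.prod_const, Finset.card_univ,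
    Fintype.card_fin, one_mul]
  rw [← Real.rpow_natCast, ← Real.rpow_mul (by positivity)]
  congr 2
  ring

end Gauss

/-! ### Trigonometric beta integrals -/

lemma integral_beta {p q : ℝ} (hp : 0 < p) (hq : 0 < q) :
    ∫ x in Set.Ioo (0 : ℝ) 1, x ^ (p - 1) * (1 - x) ^ (q - 1) =
      Real.Gamma p * Real.Gamma q / Real.Gamma (p + q) := by
  have h := Complex.betaIntegral_eq_Gamma_mul_div p q (by simpa) (by simpa)
  rw [Complex.betaIntegral, intervalIntegral.integral_of_le zero_le_one,
    integral_Ioc_eq_integral_Ioo] at h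
  have h2 : ∫ x in Set.Ioo (0 : ℝ) 1, (x : ℂ) ^ ((p : ℂ) - 1) * (1 - (x : ℂ)) ^ ((q : ℂ) - 1) =
      ∫ x in Set.Ioo (0 : ℝ) 1, ((x ^ (p - 1) * (1 - x) ^ (q - 1) : ℝ) : ℂ) := by
    refine setIntegral_congr_fun measurableSet_Ioo fun x hx => ?_
    have h0 : (0 : ℝ) ≤ 1 - x := by linarith [hx.2]
    simp only [Complex.ofReal_mul, Complex.ofReal_cpow hx.1.le, Complex.ofReal_cpow h0]
    push_cast
    rfl
  rw [h2, integral_complex_ofReal, ← Complex.ofReal_add, Complex.Gamma_ofReal,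
    Complex.Gamma_ofReal, Complex.Gamma_ofReal] at h
  exact_mod_cast h

lemma integral_sin_rpow_mul_cos_pow {a : ℝ} (ha : -1 < a) (N : ℕ) :
    ∫ φ in (0 : ℝ)..(π / 2), Real.sin φ ^ a * Real.cos φ ^ N =
      Real.Gamma ((a + 1) / 2) * Real.Gamma (((N : ℝ) + 1) / 2) /
        (2 * Real.Gamma ((a + N) / 2 + 1)) := by
  have hpi := Real.pi_pos
  have hs : ∀ φ ∈ Set.Ioo (0 : ℝ) (π / 2), 0 < Real.sin φ := fun φ h =>
    Real.sin_pos_of_pos_of_lt_pi h.1 (by linarith [h.2])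
  have hc : ∀ φ ∈ Set.Ioo (0 : ℝ) (π / 2), 0 < Real.cos φ := fun φ h =>
    Real.cos_pos_of_mem_Ioo ⟨by linarith [h.1], h.2⟩
  have himg : (fun φ => Real.sin φ ^ 2) '' Set.Ioo 0 (π / 2) = Set.Ioo 0 1 := by
    ext x
    constructor
    · rintro ⟨φ, h, rfl⟩
      refine ⟨pow_pos (hs φ h) 2, ?_⟩
      have := Real.sin_sq_add_cos_sq φ
      have := pow_pos (hc φ h) 2
      simp only
      linarith
    · rintro ⟨h0, h1⟩
      have hx0 : 0 < √x := Real.sqrt_pos.2 h0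
      have hx1 : √x < 1 := by rw [Real.sqrt_lt' one_pos]; simpa
      refine ⟨Real.arcsin √x, ⟨Real.arcsin_pos.2 hx0, Real.arcsin_lt_pi_div_two.2 hx1⟩, ?_⟩
      simp only
      rw [Real.sin_arcsin (by linarith) hx1.le, Real.sq_sqrt h0.le]
  have hinj : Set.InjOn (fun φ => Real.sin φ ^ 2) (Set.Ioo 0 (π / 2)) := by
    intro x hx y hy h
    have := (pow_left_inj₀ (hs x hx).le (hs y hy).le two_ne_zero).1 h
    exact Real.injOn_sin ⟨by linarith [hx.1], hx.2.le⟩ ⟨by linarith [hy.1], hy.2.le⟩ this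
  have hder : ∀ x ∈ Set.Ioo (0 : ℝ) (π / 2), HasDerivWithinAt (fun φ => Real.sin φ ^ 2)
      (2 * Real.sin x * Real.cos x) (Set.Ioo 0 (π / 2)) x := by
    intro x _
    exact (((Real.hasDerivAt_sin x).pow 2).congr_deriv (by simp)).hasDerivWithinAt
  have key := integral_image_eq_integral_abs_deriv_smul measurableSet_Ioo hder hinj
    (fun x => x ^ ((a + 1) / 2 - 1) * (1 - x) ^ (((N : ℝ) + 1) / 2 - 1))
  rw [himg, integral_beta (by linarith) (by positivity)] at key
  have h3 : ∫ x in Set.Ioo 0 (π / 2), |2 * Real.sin x * Real.cos x| •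
      ((Real.sin x ^ 2) ^ ((a + 1) / 2 - 1) * (1 - Real.sin x ^ 2) ^ (((N : ℝ) + 1) / 2 - 1)) =
      2 * ∫ φ in (0 : ℝ)..(π / 2), Real.sin φ ^ a * Real.cos φ ^ N := by
    rw [intervalIntegral.integral_of_le (by linarith), integral_Ioc_eq_integral_Ioo,
      ← integral_const_mul]
    refine setIntegral_congr_fun measurableSet_Ioo fun x hx => ?_
    have h1 := hs x hx
    have h2 := hc x hx
    have e : 1 - Real.sin x ^ 2 = Real.cos x ^ 2 := by linarith [Real.sin_sq_add_cos_sq x]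
    rw [e, ← Real.rpow_natCast (Real.sin x) 2, ← Real.rpow_natCast (Real.cos x) 2,
      ← Real.rpow_mul h1.le, ← Real.rpow_mul h2.le, abs_of_pos (by positivity), smul_eq_mul,
      ← Real.rpow_natCast (Real.cos x) N,
      show ((2 : ℕ) : ℝ) * ((a + 1) / 2 - 1) = a - 1 by push_cast; ring,
      show ((2 : ℕ) : ℝ) * (((N : ℝ) + 1) / 2 - 1) = N - 1 by push_cast; ring,
      Real.rpow_sub_one h1.ne', Real.rpow_sub_one h2.ne']
    field_simp
  rw [h3, show (a + 1) / 2 + ((N : ℝ) + 1) / 2 = (a + N) / 2 + 1 by ring] at key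
  rw [eq_comm, ← div_div, div_right_comm, key]
  ring

/-- The integrals `∫ sin^n cos^N` over `[-π/2, π/2]`. -/
def trigI (N n : ℕ) : ℝ := ∫ φ in (-(π / 2))..(π / 2), Real.sin φ ^ n * Real.cos φ ^ N

lemma trigI_odd (N m : ℕ) : trigI N (2 * m + 1) = 0 := by
  have h := intervalIntegral.integral_comp_neg (a := -(π / 2)) (b := π / 2)
    (fun φ : ℝ => Real.sin φ ^ (2 * m + 1) * Real.cos φ ^ N)
  simp only [Real.sin_neg, Real.cos_neg, neg_neg, Odd.neg_pow ⟨m, rfl⟩, neg_mul,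
    intervalIntegral.integral_neg] at h
  unfold trigI
  linarith

lemma trigI_even (N m : ℕ) : trigI N (2 * m) =
    ((2 * m).factorial : ℝ) * √π / (4 ^ m * m.factorial) * Real.Gamma (((N : ℝ) + 1) / 2) /
      Real.Gamma (m + (N : ℝ) / 2 + 1) := by
  have hint : ∀ a b : ℝ, IntervalIntegrable
      (fun φ : ℝ => Real.sin φ ^ (2 * m) * Real.cos φ ^ N) volume a b := fun a b =>
    Continuous.intervalIntegrable (by fun_prop) _ _
  have h := intervalIntegral.integral_comp_neg (a := 0) (b := π / 2)
    (fun φ : ℝ => Real.sin φ ^ (2 * m) * Real.cos φ ^ N)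
  simp only [Real.sin_neg, Real.cos_neg, neg_zero, (even_two_mul m).neg_pow] at h
  have h2 := integral_sin_rpow_mul_cos_pow (a := ((2 * m : ℕ) : ℝ))
    (by linarith [(2 * m).cast_nonneg (α := ℝ)]) N
  simp only [Real.rpow_natCast] at h2
  rw [trigI, ← intervalIntegral.integral_add_adjacent_intervals (hint _ 0) (hint _ _), ← h, h2,
    show (((2 * m : ℕ) : ℝ) + 1) / 2 = m + 1 / 2 by push_cast; ring,
    show (((2 * m : ℕ) : ℝ) + N) / 2 + 1 = m + (N : ℝ) / 2 + 1 by push_cast; ring,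
    Real.Gamma_nat_add_half]
  have h4 : ((2 * m).factorial : ℝ) = 2 ^ m * m.factorial * ((2 * m - 1).doubleFactorial : ℝ) := by
    rcases m with _ | m
    · simp
    · have e1 := Nat.factorial_eq_mul_doubleFactorial (2 * m + 1)
      have e2 := Nat.doubleFactorial_two_mul (m + 1)
      rw [show 2 * m + 1 + 1 = 2 * (m + 1) by ring, e2] at e1
      rw [show 2 * (m + 1) - 1 = 2 * m + 1 by omega]
      exact_mod_cast e1
  rw [h4, show (4 : ℝ) ^ m = 2 ^ m * 2 ^ m by rw [← mul_pow]; norm_num]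
  have : (m.factorial : ℝ) ≠ 0 := by positivity
  field_simp
  ring

/-! ### The Funk–Hecke formula for exponentials -/

section FunkHecke

open MvPolynomial

variable {d : ℕ}

lemma hasSum_integral_mul_exp {X : Type*} [MeasurableSpace X] {ν : Measure X} {f : X → ℝ}
    {G : X → ℂ} (hG : Integrable G ν) (hf : AEStronglyMeasurable f ν) (hf1 : ∀ x, |f x| ≤ 1)
    (z : ℂ) : HasSum (fun n : ℕ => z ^ n / n.factorial * ∫ x, G x * (f x : ℂ) ^ n ∂ν)
      (∫ x, G x * Complex.exp (z * f x) ∂ν) := by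
  have hF : ∀ n : ℕ, AEStronglyMeasurable
      (fun x => z ^ n / n.factorial * (G x * (f x : ℂ) ^ n)) ν := fun n =>
    ((hG.1.mul ((Complex.continuous_ofReal.comp_aestronglyMeasurable hf).pow n)).const_mul _)
  have h := hasSum_integral_of_dominated_convergence (μ := ν)
    (F := fun (n : ℕ) x => z ^ n / n.factorial * (G x * (f x : ℂ) ^ n))
    (f := fun x => G x * Complex.exp (z * f x))
    (fun n x => ‖z‖ ^ n / n.factorial * ‖G x‖) hF
    (fun n => Eventually.of_forall fun x => by
      rw [norm_mul, norm_mul, norm_div, norm_pow, norm_pow, Complex.norm_natCast,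
        Complex.norm_real, Real.norm_eq_abs]
      exact mul_le_mul_of_nonneg_left (mul_le_of_le_one_right (norm_nonneg _)
        (pow_le_one₀ (abs_nonneg _) (hf1 x))) (by positivity))
    (Eventually.of_forall fun x => (Real.summable_pow_div_factorial ‖z‖).mul_right _)
    (by
      simp only [tsum_mul_right]
      exact hG.norm.const_mul _)
    (Eventually.of_forall fun x => by
      have := (NormedSpace.expSeries_div_hasSum_exp (z * (f x : ℂ))).mul_left (G x)
      rw [← Complex.exp_eq_exp_ℂ] at this
      have e : (fun n : ℕ => z ^ n / n.factorial * (G x * (f x : ℂ) ^ n)) =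
          fun n : ℕ => G x * ((z * (f x : ℂ)) ^ n / n.factorial) := by
        funext n
        rw [mul_pow]
        ring
      exact e ▸ this)
  simpa only [integral_const_mul] using h

lemma continuous_evalR (p : MvPolynomial (Fin d) ℂ) : Continuous fun x : Ed d => evalR p x := by
  unfold evalR
  exact p.continuous_eval.comp (by fun_prop)

lemma integrable_sphere {f : Sph d → ℂ} (hf : Continuous f) : Integrable f (ωd d) := by
  rw [← integrableOn_univ]
  exact hf.continuousOn.integrableOn_compact isCompact_univ

lemma sphere_moment (hd : 0 < d) {p : MvPolynomial (Fin d) ℂ} {j : ℕ} (hp : p.IsHomogeneous j)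
    (hl : lap p = 0) (w : Sph d) (n : ℕ) :
    (∫ v : Sph d, evalR p v * ((⟪(w : Ed d), (v : Ed d)⟫ : ℝ) : ℂ) ^ n ∂(ωd d)) *
      ((2 ^ (((j + n : ℕ) + (d : ℝ)) / 2) * (1 / 2) * Real.Gamma (((j + n : ℕ) + (d : ℝ)) / 2) : ℝ)
        : ℂ) = ((2 * π) ^ ((d : ℝ) / 2) : ℝ) * momFac n j * evalR p w := by
  have hh : (p * linForm (w : Ed d) ^ n).IsHomogeneous (j + n) := by
    have := hp.mul ((isHomogeneous_linForm (w : Ed d)).pow n)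
    rwa [one_mul] at this
  rw [← gaussE_one, ← gaussE_harmonic w n j p hp hl, gaussE_eq_sphere hd hh]
  congr 2
  funext v
  rw [← evalR_linForm]
  simp [evalR]

/-- The constant in the Funk–Hecke formula. -/
def fhConst (d j : ℕ) : ℝ :=
  π ^ (((d : ℝ) - 1) / 2) * 2 ^ (1 - (j : ℝ)) / Real.Gamma (((2 * j + d - 2 : ℕ) + 1 : ℝ) / 2)

lemma sphere_moment_lt (hd : 0 < d) {p : MvPolynomial (Fin d) ℂ} {j : ℕ}
    (hp : p.IsHomogeneous j) (hl : lap p = 0) (w : Sph d) {n : ℕ} (hn : n < j) :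
    ∫ v : Sph d, evalR p v * ((⟪(w : Ed d), (v : Ed d)⟫ : ℝ) : ℂ) ^ n ∂(ωd d) = 0 := by
  have h := sphere_moment hd hp hl w n
  rw [momFac_eq_zero_of_lt n j hn, mul_zero, zero_mul] at h
  refine (mul_eq_zero.1 h).resolve_right ?_
  have hd' : (0 : ℝ) < d := by exact_mod_cast hd
  have := Real.Gamma_pos_of_pos (s := ((j + n : ℕ) + (d : ℝ)) / 2) (by positivity)
  exact_mod_cast (by positivity : 2 ^ (((j + n : ℕ) + (d : ℝ)) / 2) * (1 / 2) *
    Real.Gamma (((j + n : ℕ) + (d : ℝ)) / 2) ≠ 0)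

lemma sphere_moment_add (hd : 2 ≤ d) {p : MvPolynomial (Fin d) ℂ} {j : ℕ}
    (hp : p.IsHomogeneous j) (hl : lap p = 0) (w : Sph d) (n : ℕ) :
    ∫ v : Sph d, evalR p v * ((⟪(w : Ed d), (v : Ed d)⟫ : ℝ) : ℂ) ^ (n + j) ∂(ωd d) =
      evalR p w * (fhConst d j * ((n + j).factorial / n.factorial) *
        trigI (2 * j + d - 2) n : ℝ) := by
  have h := sphere_moment (by omega) hp hl w (n + j)
  have hd' : (0 : ℝ) < d := by exact_mod_cast (by omega : 0 < d)
  have hG := Real.Gamma_pos_of_pos (s := ((j + (n + j) : ℕ) + (d : ℝ)) / 2) (by positivity)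
  have hne : 2 ^ (((j + (n + j) : ℕ) + (d : ℝ)) / 2) * (1 / 2) *
    Real.Gamma (((j + (n + j) : ℕ) + (d : ℝ)) / 2) ≠ 0 := by positivity
  refine mul_right_cancel₀ (Complex.ofReal_ne_zero.2 hne) (h.trans ?_)
  obtain ⟨m, rfl | rfl⟩ := Nat.even_or_odd' n
  · rw [momFac_eq (2 * m + j) j m (by ring), trigI_even, fhConst]
    have hN : (((2 * j + d - 2 : ℕ) : ℝ)) = 2 * j + d - 2 := by
      rw [Nat.cast_sub (by omega)]; push_cast; ring
    have hj : (0 : ℝ) ≤ j := j.cast_nonneg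
    have hd2 : (2 : ℝ) ≤ d := by exact_mod_cast hd
    have hG2 := Real.Gamma_pos_of_pos (s := ((2 * j + d - 2 : ℝ) + 1) / 2) (by linarith)
    have e1 : ((j + (2 * m + j) : ℕ) + (d : ℝ)) / 2 = m + (j + d / 2) := by push_cast; ring
    have e2 : (m : ℝ) + (2 * j + d - 2) / 2 + 1 = m + (j + d / 2) := by ring
    rw [hN, e2, e1]
    rw [e1] at hG
    have e3 : (2 * π) ^ ((d : ℝ) / 2) * (2 * 2 ^ m) * 2 ^ m =
        π ^ (((d : ℝ) - 1) / 2) * 2 ^ (1 - (j : ℝ)) * √π * 2 ^ (m + (j + (d : ℝ) / 2)) * 2 ^ m := by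
      rw [Real.mul_rpow (by norm_num) Real.pi_pos.le, Real.sqrt_eq_rpow,
        show (d : ℝ) / 2 = ((d : ℝ) - 1) / 2 + 1 / 2 by ring, Real.rpow_add Real.pi_pos,
        show (m : ℝ) + (j + (((d : ℝ) - 1) / 2 + 1 / 2)) = (m + j) + (((d : ℝ) - 1) / 2 + 1 / 2) by
          ring, Real.rpow_add two_pos (m + j), Real.rpow_add two_pos (m : ℝ), Real.rpow_natCast,
        Real.rpow_sub two_pos, Real.rpow_one]
      field_simp
    have e4 : (4 : ℝ) ^ m = 2 ^ m * 2 ^ m := by rw [← mul_pow]; norm_num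
    have hm : (m.factorial : ℝ) ≠ 0 := by positivity
    have h2m : ((2 * m).factorial : ℝ) ≠ 0 := by positivity
    have key : (2 * π) ^ ((d : ℝ) / 2) * ((2 * m + j).factorial / (2 ^ m * m.factorial)) =
        π ^ (((d : ℝ) - 1) / 2) * 2 ^ (1 - (j : ℝ)) / Real.Gamma (((2 * j + d - 2 : ℝ) + 1) / 2) *
          ((2 * m + j).factorial / (2 * m).factorial) *
          ((2 * m).factorial * √π / (4 ^ m * m.factorial) *
            Real.Gamma (((2 * j + d - 2 : ℝ) + 1) / 2) / Real.Gamma (m + (j + d / 2))) *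
          (2 ^ (m + (j + (d : ℝ) / 2)) * (1 / 2) * Real.Gamma (m + (j + d / 2))) := by
      rw [e4]
      field_simp
      field_simp at e3
      linear_combination e3
    have key' := congrArg (fun x : ℝ => (x : ℂ) * evalR p w) key
    push_cast at key' ⊢
    rw [key']
    ring
  · rw [momFac_eq_zero_of_odd _ j (by
      rw [show 2 * m + 1 + j + j = 2 * (m + j) + 1 by ring]; simp), trigI_odd]
    simp

/-- The Funk–Hecke formula for exponentials. -/
lemma funk_hecke_exp (hd : 2 ≤ d) {p : MvPolynomial (Fin d) ℂ} {j : ℕ}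
    (hp : p.IsHomogeneous j) (hl : lap p = 0) (w : Sph d) (z : ℂ) :
    ∫ v : Sph d, evalR p v * Complex.exp (z * (⟪(w : Ed d), (v : Ed d)⟫ : ℝ)) ∂(ωd d) =
      evalR p w * z ^ j * fhConst d j * ∫ φ in (-(π / 2))..(π / 2),
        Complex.exp (z * (Real.sin φ : ℝ)) * (Real.cos φ ^ (2 * j + d - 2) : ℝ) := by
  have h1 := hasSum_integral_mul_exp (ν := ωd d) (G := fun v : Sph d => evalR p v)
    (f := fun v : Sph d => ⟪(w : Ed d), (v : Ed d)⟫)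
    (integrable_sphere ((continuous_evalR p).comp continuous_subtype_val))
    (by
      have : Continuous fun v : Sph d => ⟪(w : Ed d), (v : Ed d)⟫ := by fun_prop
      exact this.aestronglyMeasurable)
    (fun v => by
      have := abs_real_inner_le_norm (w : Ed d) (v : Ed d)
      simpa using this) z
  have h2 := hasSum_integral_mul_exp (ν := volume.restrict (Set.Ioc (-(π / 2)) (π / 2)))
    (G := fun φ : ℝ => ((Real.cos φ ^ (2 * j + d - 2) : ℝ) : ℂ)) (f := Real.sin)
    (Continuous.integrableOn_Ioc (by fun_prop)) Real.continuous_sin.aestronglyMeasurable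
    Real.abs_sin_le_one z
  rw [← hasSum_nat_add_iff' j, Finset.sum_eq_zero (fun n hn => by
    rw [sphere_moment_lt (by omega) hp hl w (Finset.mem_range.1 hn), mul_zero]), sub_zero] at h1
  have h3 := h2.mul_left (evalR p w * z ^ j * fhConst d j)
  have hle : -(π / 2) ≤ π / 2 := by linarith [Real.pi_pos]
  have hI : ∀ n : ℕ, ∫ φ in Set.Ioc (-(π / 2)) (π / 2),
      ((Real.cos φ ^ (2 * j + d - 2) : ℝ) : ℂ) * (Real.sin φ : ℂ) ^ n =
        (trigI (2 * j + d - 2) n : ℝ) := by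
    intro n
    rw [trigI, intervalIntegral.integral_of_le hle, ← integral_complex_ofReal]
    refine integral_congr_ae (Eventually.of_forall fun φ => ?_)
    simp only
    push_cast
    ring
  simp only [hI] at h3
  simp only [sphere_moment_add hd hp hl w] at h1
  rw [intervalIntegral.integral_of_le hle]
  simp only [mul_comm (Complex.exp _)]
  refine h1.unique ?_
  refine (congrArg (fun F : ℕ → ℂ => HasSum F _) (funext fun n => ?_)).mp h3
  have : ((n + j).factorial : ℂ) ≠ 0 := by exact_mod_cast (n + j).factorial_ne_zero
  push_cast
  rw [pow_add]
  field_simp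

lemma integral_sphere_harmonic (hd : 0 < d) {p : MvPolynomial (Fin d) ℂ} {j : ℕ} (hj : j ≠ 0)
    (hp : p.IsHomogeneous j) (hl : lap p = 0) : ∫ v : Sph d, evalR p v ∂(ωd d) = 0 := by
  have h := gaussE_eq_sphere hd hp
  rw [gaussE_eq_zero hj hp hl] at h
  refine (mul_eq_zero.1 h.symm).resolve_right ?_
  have hd' : (0 : ℝ) < d := by exact_mod_cast hd
  have := Real.Gamma_pos_of_pos (s := ((j : ℝ) + d) / 2) (by positivity)
  exact_mod_cast (by positivity : 2 ^ (((j : ℝ) + d) / 2) * (1 / 2) *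
    Real.Gamma (((j : ℝ) + d) / 2) ≠ 0)

end FunkHecke

/-! ### A regularised beta integral -/

section Contour

open Set
open scoped Interval

/-- A path in the right half plane avoiding the open unit disc. -/
structure IsEdge (W : ℝ → ℂ) (a b : ℝ) : Prop where
  cont : Continuous W
  re_nonneg : ∀ t ∈ [[a, b]], 0 ≤ (W t).re
  one_le : ∀ t ∈ [[a, b]], 1 ≤ ‖W t‖

/-- The integral of `(ε + W)^{-β} G`. -/
def edgeInt (W G : ℝ → ℂ) (a b ε : ℝ) (β : ℂ) : ℂ := ∫ t in a..b, (ε + W t) ^ (-β) * G t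

lemma one_le_norm_add {w : ℂ} {ε : ℝ} (hε : 0 ≤ ε) (hw : 0 ≤ w.re) (h1 : 1 ≤ ‖w‖) :
    1 ≤ ‖(ε : ℂ) + w‖ := by
  refine h1.trans ?_
  rw [← sq_le_sq₀ (norm_nonneg _) (norm_nonneg _), ← Complex.normSq_eq_norm_sq,
    ← Complex.normSq_eq_norm_sq, Complex.normSq_apply, Complex.normSq_apply]
  simp
  nlinarith [mul_nonneg hε hw]

lemma mem_slitPlane_of_re_nonneg {w : ℂ} (hw : 0 ≤ w.re) (h0 : w ≠ 0) : w ∈ Complex.slitPlane := by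
  rw [Complex.mem_slitPlane_iff]
  by_contra! h
  exact h0 (Complex.ext (le_antisymm h.1 hw) h.2)

variable {W G : ℝ → ℂ} {a b : ℝ}

namespace IsEdge

lemma mem_slitPlane (h : IsEdge W a b) {ε : ℝ} (hε : 0 ≤ ε) {t : ℝ} (ht : t ∈ [[a, b]]) :
    (ε : ℂ) + W t ∈ Complex.slitPlane := by
  refine mem_slitPlane_of_re_nonneg ?_ (norm_pos_iff.1 (one_pos.trans_le
    (one_le_norm_add hε (h.re_nonneg t ht) (h.one_le t ht))))
  have := h.re_nonneg t ht
  simp only [Complex.add_re, Complex.ofReal_re]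
  linarith

lemma continuousOn (h : IsEdge W a b) (hG : Continuous G) {ε : ℝ} (hε : 0 ≤ ε) (β : ℂ) :
    ContinuousOn (fun t => ((ε : ℂ) + W t) ^ (-β) * G t) [[a, b]] :=
  ((continuous_const.add h.cont).continuousOn.cpow continuousOn_const
    fun _ ht => h.mem_slitPlane hε ht).mul hG.continuousOn

lemma norm_le (h : IsEdge W a b) {ε : ℝ} (hε : 0 ≤ ε) {β : ℝ} (hβ : 0 ≤ β) {t : ℝ}
    (ht : t ∈ [[a, b]]) : ‖((ε : ℂ) + W t) ^ (-(β : ℂ)) * G t‖ ≤ ‖G t‖ := by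
  rw [norm_mul, ← Complex.ofReal_neg, Complex.norm_cpow_real]
  refine mul_le_of_le_one_left (norm_nonneg _) ?_
  exact Real.rpow_le_one_of_one_le_of_nonpos
    (one_le_norm_add hε (h.re_nonneg t ht) (h.one_le t ht)) (by linarith)

lemma exists_bound (h : IsEdge W a b) (hG : Continuous G) :
    ∃ K : ℝ, ∀ ε β : ℝ, 0 ≤ ε → 0 ≤ β → ‖edgeInt W G a b ε β‖ ≤ K := by
  obtain ⟨K, hK⟩ := (isCompact_uIcc (a := a) (b := b)).exists_bound_of_continuousOn
    hG.continuousOn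
  refine ⟨K * |b - a|, fun ε β hε hβ => ?_⟩
  refine intervalIntegral.norm_integral_le_of_norm_le_const fun t ht => ?_
  exact (h.norm_le hε hβ (uIoc_subset_uIcc ht)).trans (hK t (uIoc_subset_uIcc ht))

lemma tendsto (h : IsEdge W a b) (hG : Continuous G) {β : ℝ} (hβ : 0 ≤ β) :
    Tendsto (fun ε : ℝ => edgeInt W G a b ε β) (𝓝[>] 0) (𝓝 (edgeInt W G a b 0 β)) := by
  refine intervalIntegral.tendsto_integral_filter_of_dominated_convergence (fun t => ‖G t‖)
    ?_ ?_ (hG.norm.intervalIntegrable _ _) ?_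
  · filter_upwards [self_mem_nhdsWithin] with ε hε
    exact ((h.continuousOn hG (le_of_lt hε) β).mono uIoc_subset_uIcc).aestronglyMeasurable
      measurableSet_uIoc
  · filter_upwards [self_mem_nhdsWithin] with ε hε
    exact Eventually.of_forall fun t ht => h.norm_le (le_of_lt hε) hβ (uIoc_subset_uIcc ht)
  · refine Eventually.of_forall fun t ht => Tendsto.mul_const _ ?_
    refine Tendsto.cpow ?_ tendsto_const_nhds (h.mem_slitPlane le_rfl (uIoc_subset_uIcc ht))
    exact ((Complex.continuous_ofReal.tendsto 0).mono_left nhdsWithin_le_nhds).add_const _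

lemma differentiable (h : IsEdge W a b) (hG : Continuous G) :
    Differentiable ℂ (fun β : ℂ => edgeInt W G a b 0 β) := by
  intro β₀
  set F' : ℂ → ℝ → ℂ := fun β t =>
    ((((0 : ℝ) : ℂ) + W t) ^ (-β) * Complex.log (((0 : ℝ) : ℂ) + W t) * -1) * G t with hF'
  have hc : ContinuousOn (fun p : ℂ × ℝ => F' p.1 p.2) (univ ×ˢ [[a, b]]) := by
    have h1 : ContinuousOn (fun p : ℂ × ℝ => ((0 : ℝ) : ℂ) + W p.2) (univ ×ˢ [[a, b]]) :=
      (continuous_const.add (h.cont.comp continuous_snd)).continuousOn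
    have h2 : ∀ p ∈ (univ : Set ℂ) ×ˢ [[a, b]], ((0 : ℝ) : ℂ) + W p.2 ∈ Complex.slitPlane :=
      fun p hp => h.mem_slitPlane le_rfl hp.2
    exact (((h1.cpow continuous_fst.neg.continuousOn h2).mul (h1.clog h2)).mul
      continuousOn_const).mul (hG.comp continuous_snd).continuousOn
  obtain ⟨K, hK⟩ := ((isCompact_closedBall β₀ 1).prod
    (isCompact_uIcc (a := a) (b := b))).exists_bound_of_continuousOn
    (hc.mono (prod_mono (subset_univ _) subset_rfl))
  refine (intervalIntegral.hasDerivAt_integral_of_dominated_loc_of_deriv_le (F' := F')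
    (bound := fun _ => K) (Metric.closedBall_mem_nhds β₀ one_pos)
    (Eventually.of_forall fun β =>
      ((h.continuousOn hG le_rfl β).mono uIoc_subset_uIcc).aestronglyMeasurable
        measurableSet_uIoc)
    (h.continuousOn hG le_rfl β₀).intervalIntegrable ?_ ?_ intervalIntegrable_const ?_).2
    |>.differentiableAt
  · refine ContinuousOn.aestronglyMeasurable (ContinuousOn.mono ?_ uIoc_subset_uIcc)
      measurableSet_uIoc
    exact hc.comp (f := fun t : ℝ => (β₀, t)) (by fun_prop) fun t ht => ⟨mem_univ _, ht⟩
  · exact Eventually.of_forall fun t ht β hβ => hK (β, t) ⟨hβ, uIoc_subset_uIcc ht⟩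
  · refine Eventually.of_forall fun t ht β _ => HasDerivAt.mul_const ?_ _
    have hne := Complex.slitPlane_ne_zero (h.mem_slitPlane le_rfl (uIoc_subset_uIcc ht))
    exact (hasDerivAt_neg β).const_cpow (Or.inl hne)

end IsEdge

lemma re_I_mul_sin (z : ℂ) :
    (Complex.I * Complex.sin z).re = -(Real.cos z.re * Real.sinh z.im) := by
  rw [Complex.sin_eq]
  simp [← Complex.ofReal_sin, ← Complex.ofReal_cos, ← Complex.ofReal_cosh, ← Complex.ofReal_sinh]

lemma im_I_mul_sin (z : ℂ) : (Complex.I * Complex.sin z).im = Real.sin z.re * Real.cosh z.im := by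
  rw [Complex.sin_eq]
  simp [← Complex.ofReal_sin, ← Complex.ofReal_cos, ← Complex.ofReal_cosh, ← Complex.ofReal_sinh]

lemma normSq_I_mul_sin (z : ℂ) : ‖Complex.I * Complex.sin z‖ ^ 2 =
    Real.sin z.re ^ 2 + Real.sinh z.im ^ 2 := by
  rw [← Complex.normSq_eq_norm_sq, Complex.normSq_apply, re_I_mul_sin, im_I_mul_sin]
  have h1 := Real.cosh_sq z.im
  have h2 := Real.sin_sq_add_cos_sq z.re
  linear_combination Real.sin z.re ^ 2 * h1 + Real.sinh z.im ^ 2 * h2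

/-- The height of the rectangular contour. -/
def ctrT : ℝ := Real.arsinh 1

lemma ctrT_pos : 0 < ctrT := Real.arsinh_pos_iff.2 one_pos

lemma one_le_norm_I_mul_sin {z : ℂ} (h : 1 ≤ Real.sin z.re ^ 2 + Real.sinh z.im ^ 2) :
    1 ≤ ‖Complex.I * Complex.sin z‖ := by
  rw [← normSq_I_mul_sin] at h
  nlinarith [norm_nonneg (Complex.I * Complex.sin z)]

lemma re_I_mul_sin_nonneg {z : ℂ} (h1 : z.re ∈ Icc (-(π / 2)) (π / 2)) (h2 : z.im ≤ 0) :
    0 ≤ (Complex.I * Complex.sin z).re := by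
  rw [re_I_mul_sin]
  have := Real.cos_nonneg_of_mem_Icc h1
  have := Real.sinh_nonpos_iff.2 h2
  nlinarith

lemma isEdge_bottom :
    IsEdge (fun x => Complex.I * Complex.sin (x + (-ctrT : ℝ) * Complex.I)) (-(π / 2)) (π / 2) where
  cont := by fun_prop
  re_nonneg t ht := by
    rw [uIcc_of_le (by linarith [Real.pi_pos])] at ht
    exact re_I_mul_sin_nonneg (by simpa using ht) (by simp [ctrT_pos.le])
  one_le t ht := one_le_norm_I_mul_sin (by
    simp [Real.sinh_neg, ctrT, sq_nonneg])

lemma isEdge_side {s : ℝ} (hs : s = π / 2 ∨ s = -(π / 2)) :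
    IsEdge (fun y => Complex.I * Complex.sin (s + y * Complex.I)) (-ctrT) 0 where
  cont := by fun_prop
  re_nonneg t ht := by
    rw [uIcc_of_le (by linarith [ctrT_pos])] at ht
    have := Real.pi_pos
    refine re_I_mul_sin_nonneg ?_ (by simpa using ht.2)
    rcases hs with rfl | rfl
    · simp; linarith
    · simp; linarith
  one_le t ht := one_le_norm_I_mul_sin (by
    rcases hs with rfl | rfl <;> simp [sq_nonneg])

/-- The integral of `(ε + i sin z)^{-β} cos^N z` over the three edges of the contour away from the
real line. -/
def ctrInt (N : ℕ) (ε : ℝ) (β : ℂ) : ℂ :=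
  edgeInt (fun x => Complex.I * Complex.sin (x + (-ctrT : ℝ) * Complex.I))
      (fun x => Complex.cos (x + (-ctrT : ℝ) * Complex.I) ^ N) (-(π / 2)) (π / 2) ε β +
    Complex.I * edgeInt (fun y => Complex.I * Complex.sin ((π / 2 : ℝ) + y * Complex.I))
      (fun y => Complex.cos ((π / 2 : ℝ) + y * Complex.I) ^ N) (-ctrT) 0 ε β -
    Complex.I * edgeInt (fun y => Complex.I * Complex.sin ((-(π / 2) : ℝ) + y * Complex.I))
      (fun y => Complex.cos ((-(π / 2) : ℝ) + y * Complex.I) ^ N) (-ctrT) 0 ε β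

lemma exists_ctrInt_bound (N : ℕ) :
    ∃ K : ℝ, ∀ ε β : ℝ, 0 ≤ ε → 0 ≤ β → ‖ctrInt N ε β‖ ≤ K := by
  obtain ⟨K₁, h₁⟩ := isEdge_bottom.exists_bound
    (G := fun x => Complex.cos (x + (-ctrT : ℝ) * Complex.I) ^ N) (by fun_prop)
  obtain ⟨K₂, h₂⟩ := (isEdge_side (Or.inl rfl)).exists_bound
    (G := fun y => Complex.cos ((π / 2 : ℝ) + y * Complex.I) ^ N) (by fun_prop)
  obtain ⟨K₃, h₃⟩ := (isEdge_side (Or.inr rfl)).exists_bound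
    (G := fun y => Complex.cos ((-(π / 2) : ℝ) + y * Complex.I) ^ N) (by fun_prop)
  refine ⟨K₁ + K₂ + K₃, fun ε β hε hβ => ?_⟩
  refine (norm_sub_le _ _).trans (add_le_add ((norm_add_le _ _).trans (add_le_add
    (h₁ ε β hε hβ) ?_)) ?_)
  · rw [norm_mul, Complex.norm_I, one_mul]
    exact h₂ ε β hε hβ
  · rw [norm_mul, Complex.norm_I, one_mul]
    exact h₃ ε β hε hβ

lemma tendsto_ctrInt (N : ℕ) {β : ℝ} (hβ : 0 ≤ β) :
    Tendsto (fun ε : ℝ => ctrInt N ε β) (𝓝[>] 0) (𝓝 (ctrInt N 0 β)) :=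
  ((isEdge_bottom.tendsto (by fun_prop) hβ).add
    (((isEdge_side (Or.inl rfl)).tendsto (by fun_prop) hβ).const_mul _)).sub
    (((isEdge_side (Or.inr rfl)).tendsto (by fun_prop) hβ).const_mul _)

lemma differentiable_ctrInt (N : ℕ) : Differentiable ℂ fun β : ℂ => ctrInt N 0 β :=
  ((isEdge_bottom.differentiable (by fun_prop)).add
    (((isEdge_side (Or.inl rfl)).differentiable (by fun_prop)).const_mul _)).sub
    (((isEdge_side (Or.inr rfl)).differentiable (by fun_prop)).const_mul _)

/-- Cauchy's theorem on the rectangle. -/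
lemma integral_eq_ctrInt (N : ℕ) {ε : ℝ} (hε : 0 ≤ ε) {β : ℂ} (h : 0 < ε ∨ β.re < 0) :
    ∫ φ in (-(π / 2))..(π / 2), ((ε : ℂ) + Complex.I * Complex.sin φ) ^ (-β) *
      Complex.cos φ ^ N = ctrInt N ε β := by
  set f : ℂ → ℂ := fun z => ((ε : ℂ) + Complex.I * Complex.sin z) ^ (-β) * Complex.cos z ^ N
    with hf
  have hpi := Real.pi_pos
  have hT := ctrT_pos
  have hle : -(π / 2) ≤ π / 2 := by linarith
  have hre : ∀ z : ℂ, z.re ∈ Icc (-(π / 2)) (π / 2) → z.im ≤ 0 →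
      ε ≤ ((ε : ℂ) + Complex.I * Complex.sin z).re := by
    intro z h1 h2
    have := re_I_mul_sin_nonneg h1 h2
    simp only [Complex.add_re, Complex.ofReal_re]
    linarith
  have hcont : ContinuousOn f ([[(-(π / 2)), π / 2]] ×ℂ [[-ctrT, 0]]) := by
    intro z hz
    rw [uIcc_of_le hle, uIcc_of_le (by linarith)] at hz
    refine (ContinuousAt.mul ?_ (by fun_prop)).continuousWithinAt
    have hz' := hre z hz.1 hz.2.2
    rcases h with h | h
    · exact ContinuousAt.cpow (by fun_prop) continuousAt_const
        (Complex.mem_slitPlane_iff.2 (Or.inl (h.trans_le hz')))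
    · exact ContinuousAt.comp (g := fun w : ℂ => w ^ (-β))
        (Complex.continuousAt_cpow_const_of_re_pos (Or.inl (hε.trans hz')) (by simpa using h))
        (by fun_prop)
  have hdiff : DifferentiableOn ℂ f (Ioo (min (-(π / 2)) (π / 2)) (max (-(π / 2)) (π / 2)) ×ℂ
      Ioo (min (-ctrT) 0) (max (-ctrT) 0)) := by
    intro z hz
    rw [min_eq_left hle, max_eq_right hle, min_eq_left (by linarith),
      max_eq_right (by linarith)] at hz
    refine (DifferentiableAt.mul ?_ (by fun_prop)).differentiableWithinAt
    refine DifferentiableAt.cpow (by fun_prop) (by fun_prop) (Complex.mem_slitPlane_iff.2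
      (Or.inl ?_))
    have h1 := Real.cos_pos_of_mem_Ioo hz.1
    have h2 := Real.sinh_neg_iff.2 hz.2.2
    have := re_I_mul_sin z
    simp only [Complex.add_re, Complex.ofReal_re]
    nlinarith
  have key := Complex.integral_boundary_rect_eq_zero_of_continuousOn_of_differentiableOn f
    ⟨-(π / 2), -ctrT⟩ ⟨π / 2, 0⟩ hcont hdiff
  simp only [Complex.ofReal_zero, zero_mul, add_zero, smul_eq_mul] at key
  rw [ctrInt]
  simp only [edgeInt]
  simp only [hf] at key
  linear_combination -key

end Contour

section ContourValue

open Set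

lemma I_mul_cpow_add {s a : ℝ} (hs : 0 < s) :
    (Complex.I * s) ^ (a : ℂ) + (-(Complex.I * s)) ^ (a : ℂ) =
      ((2 * Real.cos (π * a / 2) * s ^ a : ℝ) : ℂ) := by
  have hs0 : (s : ℂ) ≠ 0 := Complex.ofReal_ne_zero.2 hs.ne'
  rw [Complex.cpow_def_of_ne_zero (mul_ne_zero Complex.I_ne_zero hs0), ← neg_mul,
    Complex.cpow_def_of_ne_zero (mul_ne_zero (neg_ne_zero.2 Complex.I_ne_zero) hs0),
    mul_comm Complex.I, mul_comm (-Complex.I), Complex.log_ofReal_mul hs Complex.I_ne_zero,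
    Complex.log_ofReal_mul hs (neg_ne_zero.2 Complex.I_ne_zero), Complex.log_I,
    Complex.log_neg_I, Real.rpow_def_of_pos hs, add_mul, add_mul, Complex.exp_add,
    Complex.exp_add]
  push_cast
  rw [Complex.cos]
  ring_nf

lemma ctrInt_zero_neg (N : ℕ) {a : ℝ} (ha0 : 0 < a) :
    ctrInt N 0 (-(a : ℂ)) = ((Real.cos (π * a / 2) * (Real.Gamma ((a + 1) / 2) *
      Real.Gamma (((N : ℝ) + 1) / 2) / Real.Gamma ((a + N) / 2 + 1)) : ℝ) : ℂ) := by
  rw [← integral_eq_ctrInt N le_rfl (Or.inr (by simpa)), neg_neg]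
  have hpi := Real.pi_pos
  set f : ℝ → ℂ := fun φ =>
    (((0 : ℝ) : ℂ) + Complex.I * Complex.sin φ) ^ (a : ℂ) * Complex.cos φ ^ N
    with hf
  have hc : Continuous f := by
    refine continuous_iff_continuousAt.2 fun φ => ContinuousAt.mul ?_ (by fun_prop)
    exact ContinuousAt.comp (g := fun w : ℂ => w ^ (a : ℂ))
        (Complex.continuousAt_cpow_const_of_re_pos (Or.inl (by
          rw [← Complex.ofReal_sin]; simp)) (by simpa using ha0))
        (by fun_prop)
  have hneg := intervalIntegral.integral_comp_neg (a := 0) (b := π / 2) f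
  rw [neg_zero] at hneg
  rw [← intervalIntegral.integral_add_adjacent_intervals
    (hc.intervalIntegrable _ 0) (hc.intervalIntegrable 0 _), ← hneg,
    ← intervalIntegral.integral_add]
  · have h2 := integral_sin_rpow_mul_cos_pow (a := a) (by linarith) N
    have h3 : ∫ φ in (0 : ℝ)..(π / 2), f (-φ) + f φ = ∫ φ in (0 : ℝ)..(π / 2),
        ((2 * Real.cos (π * a / 2) * (Real.sin φ ^ a * Real.cos φ ^ N) : ℝ) : ℂ) := by
      refine intervalIntegral.integral_congr_ae (Eventually.of_forall fun φ hφ => ?_)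
      rw [uIoc_of_le (by linarith)] at hφ
      have hs : 0 < Real.sin φ := Real.sin_pos_of_pos_of_lt_pi hφ.1 (by linarith [hφ.2])
      have := I_mul_cpow_add (a := a) hs
      simp only [hf, Complex.ofReal_zero, zero_add, Complex.ofReal_neg, Real.sin_neg, Real.cos_neg,
        mul_neg, ← Complex.ofReal_sin, ← Complex.ofReal_cos]
      rw [← add_mul, add_comm, this]
      push_cast
      ring
    rw [h3, intervalIntegral.integral_ofReal, intervalIntegral.integral_const_mul, h2]
    congr 1
    field_simp
  · exact (hc.comp continuous_neg).intervalIntegrable _ _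
  · exact hc.intervalIntegrable _ _

lemma ctrInt_zero_eq (N : ℕ) (β : ℂ) : ctrInt N 0 β =
    π * Complex.Gamma (((N : ℂ) + 1) / 2) * (Complex.Gamma ((1 + β) / 2))⁻¹ *
      (Complex.Gamma (((N : ℂ) + 2 - β) / 2))⁻¹ := by
  set R : ℂ → ℂ := fun β => π * Complex.Gamma (((N : ℂ) + 1) / 2) *
    (Complex.Gamma ((1 + β) / 2))⁻¹ * (Complex.Gamma (((N : ℂ) + 2 - β) / 2))⁻¹ with hR
  have hRd : Differentiable ℂ R := by
    have h1 : Differentiable ℂ fun β : ℂ => (Complex.Gamma ((1 + β) / 2))⁻¹ :=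
      Complex.differentiable_one_div_Gamma.comp (by fun_prop : Differentiable ℂ fun β : ℂ =>
        (1 + β) / 2)
    have h2 : Differentiable ℂ fun β : ℂ => (Complex.Gamma (((N : ℂ) + 2 - β) / 2))⁻¹ :=
      Complex.differentiable_one_div_Gamma.comp (by fun_prop : Differentiable ℂ fun β : ℂ =>
        ((N : ℂ) + 2 - β) / 2)
    exact (h1.const_mul _).mul h2
  have hval : ∀ a : ℝ, 0 < a → a < 1 → ctrInt N 0 (-(a : ℂ)) = R (-(a : ℂ)) := by
    intro a h0 h1
    have hr := Real.Gamma_mul_Gamma_one_sub ((a + 1) / 2)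
    rw [show π * ((a + 1) / 2) = π * a / 2 + π / 2 by ring, Real.sin_add_pi_div_two,
      show 1 - (a + 1) / 2 = (1 - a) / 2 by ring] at hr
    have hc : Real.cos (π * a / 2) ≠ 0 := (Real.cos_pos_of_mem_Ioo
      ⟨by nlinarith [Real.pi_pos], by nlinarith [Real.pi_pos]⟩).ne'
    have hg : Real.Gamma ((1 - a) / 2) ≠ 0 := (Real.Gamma_pos_of_pos (by linarith)).ne'
    rw [ctrInt_zero_neg N h0]
    simp only [hR]
    rw [show ((1 : ℂ) + -(a : ℂ)) / 2 = (((1 - a) / 2 : ℝ) : ℂ) by push_cast; ring,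
      show ((N : ℂ) + 2 - -(a : ℂ)) / 2 = (((a + N) / 2 + 1 : ℝ) : ℂ) by push_cast; ring,
      show ((N : ℂ) + 1) / 2 = ((((N : ℝ) + 1) / 2 : ℝ) : ℂ) by push_cast; ring,
      Complex.Gamma_ofReal, Complex.Gamma_ofReal, Complex.Gamma_ofReal]
    have e : Real.cos (π * a / 2) * Real.Gamma ((a + 1) / 2) =
        π * (Real.Gamma ((1 - a) / 2))⁻¹ := by
      rw [eq_div_iff hc] at hr
      rw [eq_mul_inv_iff_mul_eq₀ hg]
      linarith
    rw [← Complex.ofReal_inv, ← Complex.ofReal_inv, ← Complex.ofReal_mul, ← Complex.ofReal_mul,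
      ← Complex.ofReal_mul]
    congr 1
    calc _ = (Real.cos (π * a / 2) * Real.Gamma ((a + 1) / 2)) * Real.Gamma (((N : ℝ) + 1) / 2) *
        (Real.Gamma ((a + N) / 2 + 1))⁻¹ := by ring
      _ = _ := by rw [e]; ring
  have hfreq : ∃ᶠ z in 𝓝[≠] (-((1 / 2 : ℝ) : ℂ)), ctrInt N 0 z = R z := by
    have ht : Tendsto (fun a : ℝ => -(a : ℂ)) (𝓝[≠] (1 / 2)) (𝓝[≠] (-((1 / 2 : ℝ) : ℂ))) := by
      refine tendsto_nhdsWithin_iff.2 ⟨?_, ?_⟩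
      · exact (Continuous.tendsto (by fun_prop) _).mono_left nhdsWithin_le_nhds
      · filter_upwards [self_mem_nhdsWithin] with a ha h
        exact ha (Complex.ofReal_injective (neg_injective h))
    refine ht.frequently (Eventually.frequently ?_)
    filter_upwards [nhdsWithin_le_nhds (Ioo_mem_nhds (by norm_num : (0 : ℝ) < 1 / 2)
      (by norm_num : (1 / 2 : ℝ) < 1))] with a ha
    exact hval a ha.1 ha.2
  exact congrFun (AnalyticOnNhd.eq_of_frequently_eq
    (fun z _ => (differentiable_ctrInt N).analyticAt z) (fun z _ => hRd.analyticAt z) hfreq) β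

/-- The regularised beta integral at real arguments, multiplied by a Gamma factor. -/
lemma Gamma_mul_ctrInt (N : ℕ) {β : ℝ} (hβ : 0 < β) : (Real.Gamma β : ℂ) * ctrInt N 0 β =
    ((2 ^ (β - 1) * √π * Real.Gamma (((N : ℝ) + 1) / 2) *
      (Real.Gamma (β / 2) / Real.Gamma (((N : ℝ) + 2 - β) / 2)) : ℝ) : ℂ) := by
  have hl := Real.Gamma_mul_Gamma_add_half (β / 2)
  rw [show 2 * (β / 2) = β by ring, show β / 2 + 1 / 2 = (1 + β) / 2 by ring] at hl
  have hg : Real.Gamma ((1 + β) / 2) ≠ 0 := (Real.Gamma_pos_of_pos (by linarith)).ne'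
  rw [ctrInt_zero_eq,
    show ((1 : ℂ) + (β : ℂ)) / 2 = (((1 + β) / 2 : ℝ) : ℂ) by push_cast; ring,
    show ((N : ℂ) + 2 - (β : ℂ)) / 2 = ((((N : ℝ) + 2 - β) / 2 : ℝ) : ℂ) by push_cast; ring,
    show ((N : ℂ) + 1) / 2 = ((((N : ℝ) + 1) / 2 : ℝ) : ℂ) by push_cast; ring,
    Complex.Gamma_ofReal, Complex.Gamma_ofReal, Complex.Gamma_ofReal]
  rw [← Complex.ofReal_inv, ← Complex.ofReal_inv, ← Complex.ofReal_mul, ← Complex.ofReal_mul,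
    ← Complex.ofReal_mul, ← Complex.ofReal_mul]
  congr 1
  have e : Real.Gamma β * π * (Real.Gamma ((1 + β) / 2))⁻¹ =
      2 ^ (β - 1) * √π * Real.Gamma (β / 2) := by
    have h2 : (2 : ℝ) ^ (β - 1) * 2 ^ (1 - β) = 1 := by
      rw [← Real.rpow_add two_pos]; simp
    have h3 : √π * √π = π := Real.mul_self_sqrt Real.pi_pos.le
    field_simp
    calc Real.Gamma β * π = Real.Gamma β * (√π * √π) * (2 ^ (β - 1) * 2 ^ (1 - β)) := by
          rw [h2, h3, mul_one]
      _ = 2 ^ (β - 1) * √π * (Real.Gamma β * 2 ^ (1 - β) * √π) := by ring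
      _ = 2 ^ (β - 1) * √π * (Real.Gamma (β / 2) * Real.Gamma ((1 + β) / 2)) := by rw [← hl]
      _ = _ := by ring
  calc _ = (Real.Gamma β * π * (Real.Gamma ((1 + β) / 2))⁻¹) * Real.Gamma (((N : ℝ) + 1) / 2) *
      (Real.Gamma (((N : ℝ) + 2 - β) / 2))⁻¹ := by ring
    _ = _ := by rw [e]; ring

end ContourValue

section Radial

open Set

lemma exists_mul_rpow_le {α : ℝ} (hα0 : 0 < α) (hα1 : α < 1) {M : ℝ} (hM : 0 ≤ M) :
    ∃ C : ℝ, ∀ x : ℝ, 0 ≤ x → M * x ^ α ≤ C + x / 2 := by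
  set s : ℝ := (2 * (M + 1)) ^ (-(1 / (1 - α))) with hs
  have hs0 : 0 < s := Real.rpow_pos_of_pos (by linarith) _
  have h1 : s ^ (1 - α) = (2 * (M + 1))⁻¹ := by
    rw [hs, ← Real.rpow_mul (by linarith), neg_mul, one_div_mul_cancel (by linarith),
      Real.rpow_neg_one]
  have h2 : s ^ (-α) * s = (2 * (M + 1))⁻¹ := by
    rw [← h1, Real.rpow_sub hs0, Real.rpow_one, Real.rpow_neg hs0.le, div_eq_mul_inv, mul_comm]
  refine ⟨M * s ^ (-α), fun x hx => ?_⟩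
  have hy : ∀ y : ℝ, 0 ≤ y → y ^ α ≤ 1 + y := by
    intro y hy
    rcases le_total y 1 with h | h
    · linarith [Real.rpow_le_one hy h hα0.le]
    · calc y ^ α ≤ y ^ (1 : ℝ) := Real.rpow_le_rpow_of_exponent_le h hα1.le
        _ ≤ 1 + y := by rw [Real.rpow_one]; linarith
  have h3 : x ^ α = s ^ (-α) * (s * x) ^ α := by
    rw [Real.mul_rpow hs0.le hx, Real.rpow_neg hs0.le, inv_mul_cancel_left₀]
    exact (Real.rpow_pos_of_pos hs0 _).ne'
  have h4 : M * (2 * (M + 1))⁻¹ ≤ 1 / 2 := by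
    rw [← div_eq_mul_inv, div_le_iff₀ (by linarith)]
    linarith
  calc M * x ^ α ≤ M * (s ^ (-α) * (1 + s * x)) := by
        rw [h3]
        gcongr
        exact hy _ (by positivity)
    _ = M * s ^ (-α) + M * (s ^ (-α) * s) * x := by ring
    _ ≤ M * s ^ (-α) + 1 / 2 * x := by rw [h2]; gcongr
    _ = _ := by ring

lemma summable_Gamma_mul_pow_div_factorial {α : ℝ} (hα0 : 0 < α) (hα1 : α < 1) {D : ℝ}
    (hD : 0 < D) {M : ℝ} (hM : 0 ≤ M) :
    Summable fun k : ℕ => Real.Gamma (D + k * α) * M ^ k / k.factorial := by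
  obtain ⟨C, hC⟩ := exists_mul_rpow_le hα0 hα1 hM
  have hDk : ∀ k : ℕ, 0 < D + k * α := fun k => by positivity
  have hint : ∀ k : ℕ, IntegrableOn (fun x : ℝ =>
      Real.exp (-x) * x ^ (D + k * α - 1) * M ^ k / k.factorial) (Ioi 0) := fun k =>
    ((Real.GammaIntegral_convergent (hDk k)).mul_const _).div_const _
  have hdom : IntegrableOn (fun x : ℝ => Real.exp C * (x ^ (D - 1) * Real.exp (-(1 / 2) * x)))
      (Ioi 0) := by
    have := integrableOn_rpow_mul_exp_neg_mul_rpow (p := 1) (s := D - 1) (b := 1 / 2)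
      (by linarith) one_pos (by norm_num)
    simp only [Real.rpow_one] at this
    exact this.const_mul _
  refine summable_of_sum_le (c := ∫ x in Ioi (0 : ℝ),
    Real.exp C * (x ^ (D - 1) * Real.exp (-(1 / 2) * x))) (fun k => ?_) fun S => ?_
  · have := Real.Gamma_pos_of_pos (hDk k)
    positivity
  · have : ∑ k ∈ S, Real.Gamma (D + k * α) * M ^ k / k.factorial =
        ∫ x in Ioi (0 : ℝ), ∑ k ∈ S,
          Real.exp (-x) * x ^ (D + k * α - 1) * M ^ k / k.factorial := by
      rw [integral_finsetSum _ fun k _ => hint k]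
      refine Finset.sum_congr rfl fun k _ => ?_
      rw [integral_div, integral_mul_const, Real.Gamma_eq_integral (hDk k)]
    rw [this]
    refine setIntegral_mono_on (integrable_finsetSum _ fun k _ => hint k) hdom measurableSet_Ioi
      fun x hx => ?_
    have hx0 : (0 : ℝ) < x := hx
    have e : ∀ k : ℕ, Real.exp (-x) * x ^ (D + k * α - 1) * M ^ k / k.factorial =
        Real.exp (-x) * x ^ (D - 1) * ((M * x ^ α) ^ k / k.factorial) := by
      intro k
      rw [show D + k * α - 1 = (D - 1) + α * k by ring, Real.rpow_add hx0, Real.rpow_mul hx0.le,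
        Real.rpow_natCast]
      ring
    simp_rw [e]
    rw [← Finset.mul_sum]
    have hMx : 0 ≤ M * x ^ α := by positivity
    have hexp : ∑ k ∈ S, (M * x ^ α) ^ k / k.factorial ≤ Real.exp (M * x ^ α) := by
      rw [Real.exp_eq_exp_ℝ, NormedSpace.exp_eq_tsum_div]
      exact (Real.summable_pow_div_factorial _).sum_le_tsum _ fun k _ => by positivity
    calc _ ≤ Real.exp (-x) * x ^ (D - 1) * Real.exp (C + x / 2) := by
          gcongr
          exact hexp.trans (Real.exp_le_exp.2 (hC x hx0.le))
      _ = Real.exp C * (x ^ (D - 1) * (Real.exp (-x) * Real.exp (x / 2))) := by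
          rw [Real.exp_add]; ring
      _ = _ := by rw [← Real.exp_add]; ring_nf

lemma integrableOn_rpow_mul_exp_neg {β b : ℝ} (hβ : 0 < β) (hb : 0 < b) :
    IntegrableOn (fun t : ℝ => t ^ (β - 1) * Real.exp (-(b * t))) (Ioi 0) := by
  have := integrableOn_rpow_mul_exp_neg_mul_rpow (p := 1) (s := β - 1) (b := b)
    (by linarith) one_pos hb
  simpa only [Real.rpow_one, neg_mul] using this

/-- The Gamma integral with a complex rate. -/
lemma integral_rpow_mul_cexp_neg_mul {β : ℝ} (hβ : 0 < β) {z : ℂ} (hz : 0 < z.re) :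
    ∫ t in Ioi (0 : ℝ), ((t ^ (β - 1) : ℝ) : ℂ) * Complex.exp (-(z * t)) =
      z ^ (-(β : ℂ)) * (Real.Gamma β : ℂ) := by
  set U : Set ℂ := {z | 0 < z.re} with hU
  have hUo : IsOpen U := isOpen_lt continuous_const Complex.continuous_re
  have hnorm : ∀ (z : ℂ) (t : ℝ), ‖Complex.exp (-(z * t))‖ = Real.exp (-(z.re * t)) := by
    intro z t
    rw [Complex.norm_exp]
    simp
  have hmeas : ∀ (z : ℂ) (γ : ℝ), AEStronglyMeasurable
      (fun t : ℝ => ((t ^ γ : ℝ) : ℂ) * Complex.exp (-(z * t))) (volume.restrict (Ioi 0)) :=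
    fun z γ => (Measurable.mul (Measurable.complex_ofReal (by fun_prop))
      (Continuous.measurable (by fun_prop))).aestronglyMeasurable
  have hd1 : DifferentiableOn ℂ (fun z : ℂ =>
      ∫ t in Ioi (0 : ℝ), ((t ^ (β - 1) : ℝ) : ℂ) * Complex.exp (-(z * t))) U := by
    intro z₀ hz₀
    have hz₀' : 0 < z₀.re := hz₀
    refine (hasDerivAt_integral_of_dominated_loc_of_deriv_le
      (F' := fun z t => -(((t ^ (β + 1 - 1) : ℝ) : ℂ) * Complex.exp (-(z * t))))
      (bound := fun t => t ^ (β + 1 - 1) * Real.exp (-(z₀.re / 2 * t)))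
      (s := {z | z₀.re / 2 < z.re})
      ((isOpen_lt continuous_const Complex.continuous_re).mem_nhds (half_lt_self hz₀'))
      (Eventually.of_forall fun z => hmeas z _) ?_ (hmeas _ _).neg ?_
      (integrableOn_rpow_mul_exp_neg (by linarith) (half_pos hz₀')) ?_).2.differentiableAt
      |>.differentiableWithinAt
    · refine Integrable.mono' (integrableOn_rpow_mul_exp_neg hβ hz₀') (hmeas _ _) ?_
      refine (ae_restrict_mem measurableSet_Ioi).mono fun t ht => ?_
      rw [norm_mul, hnorm, Complex.norm_real,
        Real.norm_of_nonneg (Real.rpow_nonneg (le_of_lt ht) _)]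
    · refine (ae_restrict_mem measurableSet_Ioi).mono fun t ht z hz => ?_
      have ht0 : (0 : ℝ) < t := ht
      have hz' : z₀.re / 2 < z.re := hz
      rw [norm_neg, norm_mul, hnorm, Complex.norm_real,
        Real.norm_of_nonneg (Real.rpow_nonneg ht0.le _)]
      gcongr
    · refine (ae_restrict_mem measurableSet_Ioi).mono fun t ht z hz => ?_
      have ht0 : (0 : ℝ) < t := ht
      have h1 : HasDerivAt (fun z : ℂ => Complex.exp (-(z * t)))
          (Complex.exp (-(z * t)) * (-(1 * (t : ℂ)))) z :=
        ((hasDerivAt_id z).mul_const (t : ℂ)).neg.cexp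
      refine (h1.const_mul ((t ^ (β - 1) : ℝ) : ℂ)).congr_deriv ?_
      rw [show β + 1 - 1 = (β - 1) + 1 by ring, Real.rpow_add_one ht0.ne']
      push_cast
      ring
  have hd2 : DifferentiableOn ℂ (fun z : ℂ => z ^ (-(β : ℂ)) * (Real.Gamma β : ℂ)) U := by
    intro z hz
    exact ((differentiableAt_id.cpow_const (Or.inl hz)).mul_const _).differentiableWithinAt
  have hconn : IsPreconnected U := (convex_halfSpace_re_gt 0).isPreconnected
  have hval : ∀ t : ℝ, 0 < t → ∫ s in Ioi (0 : ℝ), ((s ^ (β - 1) : ℝ) : ℂ) *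
      Complex.exp (-((t : ℂ) * s)) = (t : ℂ) ^ (-(β : ℂ)) * (Real.Gamma β : ℂ) := by
    intro t ht
    have h := Real.integral_rpow_mul_exp_neg_mul_Ioi hβ ht
    have h2 : ∫ s in Ioi (0 : ℝ), ((s ^ (β - 1) : ℝ) : ℂ) * Complex.exp (-((t : ℂ) * s)) =
        ((∫ s in Ioi (0 : ℝ), s ^ (β - 1) * Real.exp (-(t * s)) : ℝ) : ℂ) := by
      rw [← integral_complex_ofReal]
      push_cast
      rfl
    rw [h2, h, one_div, Real.inv_rpow ht.le, ← Real.rpow_neg ht.le, Complex.ofReal_mul,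
      Complex.ofReal_cpow ht.le]
    push_cast
    rfl
  have hfreq : ∃ᶠ z in 𝓝[≠] ((1 : ℝ) : ℂ), ∫ t in Ioi (0 : ℝ), ((t ^ (β - 1) : ℝ) : ℂ) *
      Complex.exp (-(z * t)) = z ^ (-(β : ℂ)) * (Real.Gamma β : ℂ) := by
    have ht : Tendsto (fun a : ℝ => (a : ℂ)) (𝓝[≠] 1) (𝓝[≠] ((1 : ℝ) : ℂ)) := by
      refine tendsto_nhdsWithin_iff.2 ⟨?_, ?_⟩
      · exact (Continuous.tendsto (by fun_prop) _).mono_left nhdsWithin_le_nhds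
      · filter_upwards [self_mem_nhdsWithin] with a ha h
        exact ha (Complex.ofReal_injective h)
    refine ht.frequently (Eventually.frequently ?_)
    filter_upwards [nhdsWithin_le_nhds (Ioi_mem_nhds (zero_lt_one : (0 : ℝ) < 1))] with a ha
    exact hval a ha
  exact AnalyticOnNhd.eqOn_of_preconnected_of_frequently_eq (hd1.analyticOnNhd hUo)
    (hd2.analyticOnNhd hUo) hconn (by simp [hU]) hfreq hz

/-- A Poisson-type integral, equal to a Bessel function up to a power and a constant. -/
def besselKernel (N : ℕ) (x : ℝ) : ℂ :=
  ∫ φ in -(π / 2)..π / 2, Complex.exp (-(Complex.I * x * Complex.sin φ)) * Complex.cos φ ^ N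

lemma norm_besselKernel_integrand_le (N : ℕ) (x φ : ℝ) :
    ‖Complex.exp (-(Complex.I * x * Complex.sin φ)) * Complex.cos φ ^ N‖ ≤ 1 := by
  rw [norm_mul, norm_pow, ← Complex.ofReal_sin, ← Complex.ofReal_cos,
    show -(Complex.I * (x : ℂ) * (Real.sin φ : ℂ)) = ((-(x * Real.sin φ) : ℝ) : ℂ) * Complex.I by
      push_cast; ring, Complex.norm_exp_ofReal_mul_I, one_mul, Complex.norm_real]
  exact pow_le_one₀ (norm_nonneg _) (Real.abs_cos_le_one φ)

lemma norm_besselKernel_le (N : ℕ) (x : ℝ) : ‖besselKernel N x‖ ≤ π := by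
  have := intervalIntegral.norm_integral_le_of_norm_le_const (a := -(π / 2)) (b := π / 2)
    (f := fun φ : ℝ => Complex.exp (-(Complex.I * x * Complex.sin φ)) * Complex.cos φ ^ N)
    (C := 1) fun φ _ => norm_besselKernel_integrand_le N x φ
  refine this.trans_eq ?_
  rw [sub_neg_eq_add, add_halves, one_mul, abs_of_pos Real.pi_pos]

lemma continuous_besselKernel (N : ℕ) : Continuous (besselKernel N) :=
  intervalIntegral.continuous_parametric_intervalIntegral_of_continuous' (by fun_prop) _ _

lemma integral_rpow_mul_besselKernel (N : ℕ) {β ε r : ℝ} (hβ : 0 < β) (hε : 0 < ε) (hr : 0 < r) :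
    ∫ ρ in Ioi (0 : ℝ), ((ρ ^ (β - 1) * Real.exp (-(ε * r * ρ)) : ℝ) : ℂ) * besselKernel N (r * ρ) =
      ((r ^ (-β) * Real.Gamma β : ℝ) : ℂ) * ctrInt N ε β := by
  have hint := integrableOn_rpow_mul_exp_neg hβ (b := ε * r) (by positivity)
  rw [← integral_eq_ctrInt N hε.le (Or.inl hε), ← intervalIntegral.integral_const_mul]
  simp only [besselKernel]
  simp_rw [← intervalIntegral.integral_const_mul]
  have hle : -(π / 2) ≤ π / 2 := by linarith [Real.pi_pos]
  simp_rw [intervalIntegral.integral_of_le hle]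
  rw [integral_integral_swap]
  · refine integral_congr_ae (Eventually.of_forall fun φ => ?_)
    have hz : (0 : ℝ) < ((r : ℂ) * ((ε : ℂ) + Complex.I * Complex.sin φ)).re := by
      rw [← Complex.ofReal_sin]
      simp [hr, hε]
    have key := integral_rpow_mul_cexp_neg_mul hβ hz
    have hcp : ((r : ℂ) * ((ε : ℂ) + Complex.I * Complex.sin φ)) ^ (-(β : ℂ)) =
        ((r ^ (-β) : ℝ) : ℂ) * ((ε : ℂ) + Complex.I * Complex.sin φ) ^ (-(β : ℂ)) := by
      have hne : ((ε : ℂ) + Complex.I * Complex.sin φ) ≠ 0 := fun h => by simp [h] at hz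
      rw [Complex.cpow_def_of_ne_zero (mul_ne_zero (Complex.ofReal_ne_zero.2 hr.ne') hne),
        Complex.log_ofReal_mul hr hne, add_mul, Complex.exp_add,
        ← Complex.cpow_def_of_ne_zero hne, Real.rpow_def_of_pos hr]
      push_cast
      rfl
    rw [hcp] at key
    calc _ = ∫ ρ in Ioi (0 : ℝ), (((ρ ^ (β - 1) : ℝ) : ℂ) * Complex.exp
          (-((r : ℂ) * ((ε : ℂ) + Complex.I * Complex.sin φ) * ρ))) * Complex.cos φ ^ N := by
          refine setIntegral_congr_fun measurableSet_Ioi fun ρ hρ => ?_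
          rw [Complex.ofReal_mul, Complex.ofReal_exp, mul_assoc,
            ← mul_assoc (Complex.exp _), ← Complex.exp_add, ← mul_assoc]
          push_cast
          ring_nf
      _ = _ := by
          rw [integral_mul_const, key]
          push_cast
          ring
  · refine Integrable.mono' (g := fun p : ℝ × ℝ => p.1 ^ (β - 1) * Real.exp (-(ε * r * p.1)) * 1)
      (Integrable.mul_prod (f := fun ρ : ℝ => ρ ^ (β - 1) * Real.exp (-(ε * r * ρ)))
        (g := fun _ => (1 : ℝ)) hint (integrable_const _)) ?_ ?_
    · refine AEStronglyMeasurable.mul ?_ (Continuous.aestronglyMeasurable (by fun_prop))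
      exact (Measurable.complex_ofReal (by fun_prop)).aestronglyMeasurable
    · rw [Measure.prod_restrict]
      refine (ae_restrict_mem (measurableSet_Ioi.prod measurableSet_Ioc)).mono fun p hp => ?_
      have hp0 : (0 : ℝ) < p.1 := hp.1
      rw [Function.uncurry_def, norm_mul, Complex.norm_real, Real.norm_of_nonneg (by positivity)]
      gcongr
      exact norm_besselKernel_integrand_le N _ _

end Radial

section RadialExpansion

open Set

lemma rpow_neg_add_natCast_mul {x : ℝ} (hx : 0 < x) (D α : ℝ) (k : ℕ) :
    x ^ (-(D + k * α)) = x ^ (-D) * (x ^ (-α)) ^ k := by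
  rw [← Real.rpow_natCast, ← Real.rpow_mul hx.le, ← Real.rpow_add hx]
  ring_nf

lemma hasSum_damped_radial (N : ℕ) {α D r ε : ℝ} (hα0 : 0 < α) (hα1 : α < 1) (hD : 0 < D)
    (hr : 0 < r) (hε : 0 < ε) (V : ℂ) :
    HasSum (fun k : ℕ => (-V) ^ k / k.factorial *
      (((r ^ (-(D + k * α)) * Real.Gamma (D + k * α) : ℝ) : ℂ) * ctrInt N ε (D + k * α : ℝ)))
    (∫ ρ in Ioi (0 : ℝ), ((ρ ^ (D - 1) : ℝ) : ℂ) * Complex.exp (-((ρ ^ α : ℝ) * V)) *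
      ((Real.exp (-(ε * r * ρ)) : ℝ) : ℂ) * besselKernel N (r * ρ)) := by
  have hDk : ∀ k : ℕ, 0 < D + k * α := fun k => by positivity
  have hεr : 0 < ε * r := by positivity
  set F : ℕ → ℝ → ℂ := fun k ρ => (-V) ^ k / k.factorial *
    (((ρ ^ (D + k * α - 1) * Real.exp (-(ε * r * ρ)) : ℝ) : ℂ) * besselKernel N (r * ρ)) with hF
  have hBc : Continuous fun ρ : ℝ => besselKernel N (r * ρ) :=
    (continuous_besselKernel N).comp (continuous_const.mul continuous_id)
  have hreal : ∀ k : ℕ, IntegrableOn (fun ρ : ℝ => ‖(-V) ^ k / k.factorial‖ *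
      (ρ ^ (D + k * α - 1) * Real.exp (-(ε * r * ρ)) * π)) (Ioi 0) := fun k =>
    ((integrableOn_rpow_mul_exp_neg (hDk k) hεr).mul_const π).const_mul _
  have hbound : ∀ k : ℕ, ∀ ρ ∈ Ioi (0 : ℝ), ‖F k ρ‖ ≤ ‖(-V) ^ k / k.factorial‖ *
      (ρ ^ (D + k * α - 1) * Real.exp (-(ε * r * ρ)) * π) := by
    intro k ρ hρ
    have hρ0 : (0 : ℝ) < ρ := hρ
    rw [hF, norm_mul, norm_mul, Complex.norm_real, Real.norm_of_nonneg (by positivity)]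
    gcongr
    exact norm_besselKernel_le N _
  have hint : ∀ k : ℕ, IntegrableOn (F k) (Ioi 0) := by
    intro k
    refine Integrable.mono' (hreal k) ?_ ((ae_restrict_mem measurableSet_Ioi).mono (hbound k))
    refine Measurable.aestronglyMeasurable (measurable_const.mul (Measurable.mul ?_ hBc.measurable))
    exact Measurable.complex_ofReal (by fun_prop)
  have hsum : Summable fun k : ℕ => ∫ ρ in Ioi (0 : ℝ), ‖F k ρ‖ := by
    have hs := (summable_Gamma_mul_pow_div_factorial hα0 hα1 hD
      (M := ‖V‖ * (ε * r) ^ (-α)) (by positivity)).mul_left (π * (ε * r) ^ (-D))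
    refine Summable.of_nonneg_of_le (fun k => integral_nonneg fun _ => norm_nonneg _)
      (fun k => ?_) hs
    refine (setIntegral_mono_on (hint k).norm (hreal k) measurableSet_Ioi (hbound k)).trans_eq ?_
    rw [integral_const_mul, integral_mul_const, Real.integral_rpow_mul_exp_neg_mul_Ioi (hDk k) hεr,
      one_div, Real.inv_rpow hεr.le, ← Real.rpow_neg hεr.le, rpow_neg_add_natCast_mul hεr,
      norm_div, norm_pow, norm_neg, Complex.norm_natCast]
    ring
  have h := hasSum_integral_of_summable_integral_norm hint hsum
  have e1 : ∀ k : ℕ, ∫ ρ in Ioi (0 : ℝ), F k ρ = (-V) ^ k / k.factorial *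
      (((r ^ (-(D + k * α)) * Real.Gamma (D + k * α) : ℝ) : ℂ) * ctrInt N ε (D + k * α : ℝ)) := by
    intro k
    rw [hF, integral_const_mul, integral_rpow_mul_besselKernel N (hDk k) hε hr]
  simp_rw [e1] at h
  suffices e2 : ∫ ρ in Ioi (0 : ℝ), ((ρ ^ (D - 1) : ℝ) : ℂ) * Complex.exp (-((ρ ^ α : ℝ) * V)) *
      ((Real.exp (-(ε * r * ρ)) : ℝ) : ℂ) * besselKernel N (r * ρ) =
      ∫ ρ in Ioi (0 : ℝ), ∑' k, F k ρ by rwa [e2]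
  refine setIntegral_congr_fun (s := Ioi (0 : ℝ)) measurableSet_Ioi fun ρ hρ => ?_
  have hρ0 : (0 : ℝ) < ρ := hρ
  have hexp : HasSum (fun k : ℕ => (-((ρ ^ α : ℝ) * V)) ^ k / k.factorial)
      (Complex.exp (-((ρ ^ α : ℝ) * V))) := by
    rw [Complex.exp_eq_exp_ℂ]
    exact NormedSpace.expSeries_div_hasSum_exp _
  have h2 := hexp.mul_left (((ρ ^ (D - 1) : ℝ) : ℂ) * ((Real.exp (-(ε * r * ρ)) : ℝ) : ℂ) *
    besselKernel N (r * ρ))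
  refine Eq.trans ?_ (h2.tsum_eq.symm.trans (tsum_congr fun k => ?_))
  · ring
  · rw [hF]
    simp only
    rw [show D + k * α - 1 = (D - 1) + α * k by ring, Real.rpow_add hρ0, Real.rpow_mul hρ0.le,
      Real.rpow_natCast, ← mul_neg (((ρ ^ α : ℝ) : ℂ)) V, mul_pow]
    push_cast
    ring

lemma hasSum_radial (N : ℕ) {α D r : ℝ} (hα0 : 0 < α) (hα1 : α < 1) (hD : 0 < D)
    (hr : 0 < r) {V : ℂ} (hV : 0 < V.re) :
    HasSum (fun k : ℕ => (-V) ^ k / k.factorial *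
      (((r ^ (-(D + k * α)) * Real.Gamma (D + k * α) : ℝ) : ℂ) * ctrInt N 0 (D + k * α : ℝ)))
    (∫ ρ in Ioi (0 : ℝ), ((ρ ^ (D - 1) : ℝ) : ℂ) * Complex.exp (-((ρ ^ α : ℝ) * V)) *
      besselKernel N (r * ρ)) := by
  have hDk : ∀ k : ℕ, 0 < D + k * α := fun k => by positivity
  obtain ⟨K, hK⟩ := exists_ctrInt_bound N
  have hK0 : 0 ≤ K := (norm_nonneg _).trans (hK 0 0 le_rfl le_rfl)
  have hBc : Continuous fun ρ : ℝ => besselKernel N (r * ρ) :=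
    (continuous_besselKernel N).comp (continuous_const.mul continuous_id)
  have hs := (summable_Gamma_mul_pow_div_factorial hα0 hα1 hD
    (M := ‖V‖ * r ^ (-α)) (by positivity)).mul_left (K * r ^ (-D))
  have hb : ∀ (ε : ℝ), 0 ≤ ε → ∀ k : ℕ, ‖(-V) ^ k / k.factorial *
      (((r ^ (-(D + k * α)) * Real.Gamma (D + k * α) : ℝ) : ℂ) * ctrInt N ε (D + k * α : ℝ))‖ ≤
      K * r ^ (-D) * (Real.Gamma (D + k * α) * (‖V‖ * r ^ (-α)) ^ k / k.factorial) := by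
    intro ε hε k
    have hG := Real.Gamma_pos_of_pos (hDk k)
    rw [norm_mul, norm_mul, norm_div, norm_pow, norm_neg, Complex.norm_natCast, Complex.norm_real,
      Real.norm_of_nonneg (by positivity), rpow_neg_add_natCast_mul hr]
    calc _ ≤ ‖V‖ ^ k / k.factorial *
        (r ^ (-D) * (r ^ (-α)) ^ k * Real.Gamma (D + k * α) * K) := by
          gcongr
          exact hK ε _ hε (hDk k).le
      _ = _ := by ring
  have hlim := tendsto_tsum_of_dominated_convergence (𝓕 := 𝓝[>] (0 : ℝ))
    (f := fun (ε : ℝ) (k : ℕ) => (-V) ^ k / k.factorial *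
      (((r ^ (-(D + k * α)) * Real.Gamma (D + k * α) : ℝ) : ℂ) * ctrInt N ε (D + k * α : ℝ))) hs
    (fun k => ((tendsto_ctrInt N (hDk k).le).const_mul _).const_mul _)
    (by filter_upwards [self_mem_nhdsWithin] with ε hε using hb ε (le_of_lt hε))
  have hlim2 : Tendsto (fun ε : ℝ => ∫ ρ in Ioi (0 : ℝ), ((ρ ^ (D - 1) : ℝ) : ℂ) *
      Complex.exp (-((ρ ^ α : ℝ) * V)) * ((Real.exp (-(ε * r * ρ)) : ℝ) : ℂ) *
        besselKernel N (r * ρ)) (𝓝[>] 0)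
      (𝓝 (∫ ρ in Ioi (0 : ℝ), ((ρ ^ (D - 1) : ℝ) : ℂ) * Complex.exp (-((ρ ^ α : ℝ) * V)) *
        besselKernel N (r * ρ))) := by
    refine tendsto_integral_filter_of_dominated_convergence
      (fun ρ => ρ ^ (D - 1) * Real.exp (-V.re * ρ ^ α) * π) ?_ ?_
      ((integrableOn_rpow_mul_exp_neg_mul_rpow (by linarith) hα0 hV).mul_const π) ?_
    · refine Eventually.of_forall fun ε => Measurable.aestronglyMeasurable ?_
      refine Measurable.mul (Measurable.mul (Measurable.mul ?_ ?_) ?_) hBc.measurable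
      · exact Measurable.complex_ofReal (by fun_prop)
      · exact Complex.measurable_exp.comp
          ((Measurable.complex_ofReal (by fun_prop)).mul_const _).neg
      · exact Measurable.complex_ofReal (by fun_prop)
    · filter_upwards [self_mem_nhdsWithin] with ε hε
      have hε0 : (0 : ℝ) < ε := hε
      refine (ae_restrict_mem measurableSet_Ioi).mono fun ρ hρ => ?_
      have hρ0 : (0 : ℝ) < ρ := hρ
      rw [norm_mul, norm_mul, norm_mul, Complex.norm_real, Complex.norm_real, Complex.norm_exp,
        Real.norm_of_nonneg (by positivity), Real.norm_of_nonneg (by positivity), Complex.neg_re,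
        Complex.re_ofReal_mul]
      calc _ ≤ ρ ^ (D - 1) * Real.exp (-(ρ ^ α * V.re)) * 1 * π := by
            gcongr
            · exact Real.exp_le_one_iff.2 (neg_nonpos.2 (by positivity))
            · exact norm_besselKernel_le N _
        _ = _ := by ring_nf
    · refine Eventually.of_forall fun ρ => ?_
      refine Tendsto.mul_const _ ?_
      have hc : Continuous fun ε : ℝ => ((ρ ^ (D - 1) : ℝ) : ℂ) *
          Complex.exp (-((ρ ^ α : ℝ) * V)) * ((Real.exp (-(ε * r * ρ)) : ℝ) : ℂ) := by fun_prop
      have := (hc.tendsto 0).mono_left (nhdsWithin_le_nhds (s := Ioi 0))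
      simpa using this
  have heq : (fun ε : ℝ => ∫ ρ in Ioi (0 : ℝ), ((ρ ^ (D - 1) : ℝ) : ℂ) *
      Complex.exp (-((ρ ^ α : ℝ) * V)) * ((Real.exp (-(ε * r * ρ)) : ℝ) : ℂ) *
        besselKernel N (r * ρ)) =ᶠ[𝓝[>] 0] fun ε => ∑' k : ℕ, (-V) ^ k / k.factorial *
      (((r ^ (-(D + k * α)) * Real.Gamma (D + k * α) : ℝ) : ℂ) * ctrInt N ε (D + k * α : ℝ)) := by
    filter_upwards [self_mem_nhdsWithin] with ε hε
    exact (hasSum_damped_radial N hα0 hα1 hD hr hε V).tsum_eq.symm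
  rw [tendsto_nhds_unique (hlim2.congr' heq) hlim]
  exact (hs.of_norm_bounded (hb 0 le_rfl)).hasSum

end RadialExpansion

section CharExp

open Set

variable {d : ℕ} {α : ℝ}

/-- The one-dimensional `α`-stable exponent. -/
def stableKernel (α : ℝ) (s : ℝ) : ℂ :=
  (|s| ^ α : ℝ) * (1 - Complex.I * (Real.tan (π * α / 2) : ℂ) * (Real.sign s : ℂ))

lemma stableKernel_eq (hα0 : 0 < α) (s : ℝ) : stableKernel α s =
    (max s 0 ^ α : ℝ) * (1 - Complex.I * (Real.tan (π * α / 2) : ℂ)) +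
      (max (-s) 0 ^ α : ℝ) * (1 + Complex.I * (Real.tan (π * α / 2) : ℂ)) := by
  unfold stableKernel
  rcases lt_trichotomy s 0 with h | h | h
  · rw [abs_of_neg h, Real.sign_of_neg h, max_eq_right h.le, max_eq_left (by linarith),
      Real.zero_rpow hα0.ne']
    push_cast
    ring
  · simp [h, Real.zero_rpow hα0.ne']
  · rw [abs_of_pos h, Real.sign_of_pos h, max_eq_left h.le, max_eq_right (by linarith),
      Real.zero_rpow hα0.ne']
    push_cast
    ring

lemma continuous_stableKernel (hα0 : 0 < α) : Continuous (stableKernel α) := by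
  have h1 : Continuous fun s : ℝ => max s 0 ^ α :=
    (continuous_id.max continuous_const).rpow_const fun _ => Or.inr hα0.le
  have h2 : Continuous fun s : ℝ => max (-s) 0 ^ α :=
    (continuous_neg.max continuous_const).rpow_const fun _ => Or.inr hα0.le
  rw [funext (stableKernel_eq hα0)]
  fun_prop

lemma stableKernel_mul (α : ℝ) {r : ℝ} (hr : 0 < r) (s : ℝ) :
    stableKernel α (r * s) = (r ^ α : ℝ) * stableKernel α s := by
  have : Real.sign (r * s) = Real.sign s := by
    rcases lt_trichotomy s 0 with h | h | h
    · rw [Real.sign_of_neg h, Real.sign_of_neg (mul_neg_of_pos_of_neg hr h)]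
    · simp [h]
    · rw [Real.sign_of_pos h, Real.sign_of_pos (mul_pos hr h)]
  unfold stableKernel
  rw [this, abs_mul, abs_of_pos hr, Real.mul_rpow hr.le (abs_nonneg s)]
  push_cast
  ring

lemma stableKernel_re (α s : ℝ) : (stableKernel α s).re = |s| ^ α := by
  rw [stableKernel, Complex.re_ofReal_mul, mul_assoc, ← Complex.ofReal_mul, Complex.sub_re,
    Complex.re_mul_ofReal]
  simp

lemma charExp_eq (Λ : Measure (Sph d)) (z : Ed d) :
    charExp d α Λ z = ∫ v, stableKernel α ⟪z, (v : Ed d)⟫ ∂Λ := rfl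

lemma charExp_smul (Λ : Measure (Sph d)) {ρ : ℝ} (hρ : 0 < ρ) (z : Ed d) :
    charExp d α Λ (ρ • z) = (ρ ^ α : ℝ) * charExp d α Λ z := by
  simp_rw [charExp_eq, real_inner_smul_left, stableKernel_mul α hρ]
  rw [integral_const_mul]

lemma charExp_eq_rpow_mul (Λ : Measure (Sph d)) {ρ : ℝ} (hρ : 0 < ρ) (u : Sph d) :
    charExp d α Λ (ρ • (u : Ed d)) = (ρ ^ α : ℝ) * Vfun d α Λ u :=
  charExp_smul Λ hρ _

variable (Λ : Measure (Sph d)) [IsFiniteMeasure Λ]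

lemma continuous_charExp (hα0 : 0 < α) : Continuous (charExp d α Λ) := by
  have hc : Continuous (Function.uncurry fun (z : Ed d) (v : Sph d) =>
      stableKernel α ⟪z, (v : Ed d)⟫) :=
    (continuous_stableKernel hα0).comp (by fun_prop)
  have := continuous_parametric_integral_of_continuous (μ := Λ) hc isCompact_univ
  simp only [Measure.restrict_univ] at this
  exact this

lemma continuous_Vfun (hα0 : 0 < α) : Continuous (Vfun d α Λ) :=
  (continuous_charExp Λ hα0).comp continuous_subtype_val

lemma integrable_stableKernel_inner (hα0 : 0 < α) (z : Ed d) :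
    Integrable (fun v : Sph d => stableKernel α ⟪z, (v : Ed d)⟫) Λ := by
  rw [← integrableOn_univ]
  exact ((continuous_stableKernel hα0).comp (by fun_prop)).continuousOn.integrableOn_compact
    isCompact_univ

lemma charExp_re (hα0 : 0 < α) (z : Ed d) :
    (charExp d α Λ z).re = ∫ v : Sph d, |⟪z, (v : Ed d)⟫| ^ α ∂Λ := by
  rw [charExp_eq, ← Complex.reCLM_apply,
    ← Complex.reCLM.integral_comp_comm (integrable_stableKernel_inner Λ hα0 z)]
  simp [stableKernel_re]

lemma Vfun_re_pos (hα0 : 0 < α) {μ : Measure (Ed d)} [IsProbabilityMeasure μ]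
    (hμ : IsStableChar d α Λ μ) (hnd : Nondegenerate d μ) (u : Sph d) :
    0 < (Vfun d α Λ u).re := by
  have hnn : 0 ≤ fun v : Sph d => |⟪(u : Ed d), (v : Ed d)⟫| ^ α := fun v => by positivity
  have hre : (Vfun d α Λ u).re = ∫ v : Sph d, |⟪(u : Ed d), (v : Ed d)⟫| ^ α ∂Λ :=
    charExp_re Λ hα0 u
  refine lt_of_le_of_ne (by rw [hre]; exact integral_nonneg hnn) fun h0 => ?_
  rw [hre, eq_comm, integral_eq_zero_iff_of_nonneg hnn] at h0
  swap
  · have := (integrable_stableKernel_inner Λ hα0 (u : Ed d)).re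
    simpa [stableKernel_re] using this
  have hz : ∀ᵐ v : Sph d ∂Λ, ⟪(u : Ed d), (v : Ed d)⟫ = 0 := by
    filter_upwards [h0] with v hv
    simpa [Real.rpow_eq_zero_iff_of_nonneg, hα0.ne'] using hv
  have hcz : ∀ t : ℝ, charExp d α Λ (t • (u : Ed d)) = 0 := by
    intro t
    rw [charExp_eq]
    refine integral_eq_zero_of_ae (hz.mono fun v hv => ?_)
    simp [real_inner_smul_left, hv, stableKernel, Real.zero_rpow hα0.ne']
  have hmeas : Measurable fun x : Ed d => ⟪(u : Ed d), x⟫ := by fun_prop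
  have hdirac : μ.map (fun x : Ed d => ⟪(u : Ed d), x⟫) = Measure.dirac 0 := by
    have : IsProbabilityMeasure (μ.map (fun x : Ed d => ⟪(u : Ed d), x⟫)) :=
      Measure.isProbabilityMeasure_map hmeas.aemeasurable
    refine Measure.ext_of_charFun (funext fun t => ?_)
    rw [charFun_apply_real, integral_map hmeas.aemeasurable (by fun_prop), charFun_dirac]
    have := hμ (t • (u : Ed d))
    rw [hcz] at this
    simp only [real_inner_smul_left, neg_zero, Complex.exp_zero] at this
    simp only [inner_zero_left, Complex.ofReal_zero, zero_mul, Complex.exp_zero]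
    rw [← this]
    congr 1
    ext x
    push_cast
    ring_nf
  have hW : LinearMap.ker (innerₛₗ ℝ (u : Ed d)) ≠ ⊤ := by
    intro h
    have h1 : (u : Ed d) ∈ LinearMap.ker (innerₛₗ ℝ (u : Ed d)) := h ▸ Submodule.mem_top
    simp [norm_eq_of_mem_sphere u] at h1
  have h3 := hnd 0 _ hW
  have h4 : (fun x : Ed d => (0 : Ed d) + x) ''
      (LinearMap.ker (innerₛₗ ℝ (u : Ed d)) : Set (Ed d)) =
      (fun x : Ed d => ⟪(u : Ed d), x⟫) ⁻¹' {0} := by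
    ext x
    simp
  rw [h4, ← Measure.map_apply hmeas (measurableSet_singleton 0), hdirac] at h3
  simp at h3

lemma exists_Vfun_bounds (hd : 0 < d) (hα0 : 0 < α) (hpos : ∀ u, 0 < (Vfun d α Λ u).re) :
    ∃ c K : ℝ, 0 < c ∧ ∀ u, c ≤ (Vfun d α Λ u).re ∧ ‖Vfun d α Λ u‖ ≤ K := by
  have : NeZero d := ⟨hd.ne'⟩
  have hne : (univ : Set (Sph d)).Nonempty :=
    ⟨⟨EuclideanSpace.single 0 1, by simp⟩, mem_univ _⟩
  have hV := continuous_Vfun Λ hα0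
  obtain ⟨u₀, -, h₀⟩ := isCompact_univ.exists_isMinOn hne
    (Complex.continuous_re.comp hV).continuousOn
  obtain ⟨u₁, -, h₁⟩ := isCompact_univ.exists_isMaxOn hne hV.norm.continuousOn
  exact ⟨_, _, hpos u₀, fun u => ⟨h₀ (mem_univ u), h₁ (mem_univ u)⟩⟩

lemma integrable_exp_neg_charExp (hd : 0 < d) (hα0 : 0 < α) (hpos : ∀ u, 0 < (Vfun d α Λ u).re) :
    Integrable fun z : Ed d => Complex.exp (-charExp d α Λ z) := by
  obtain ⟨c, K, hc, hcK⟩ := exists_Vfun_bounds Λ hd hα0 hpos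
  have : Nonempty (Fin d) := ⟨⟨0, hd⟩⟩
  have hbd : Integrable fun z : Ed d => Real.exp (-c * ‖z‖ ^ α) := by
    rw [integrable_fun_norm_addHaar (volume : Measure (Ed d)) (f := fun t => Real.exp (-c * t ^ α))]
    have h := integrableOn_rpow_mul_exp_neg_mul_rpow (s := ((d - 1 : ℕ) : ℝ)) (p := α) (b := c)
      (by linarith [(d - 1 : ℕ).cast_nonneg (α := ℝ)]) hα0 hc
    simpa using h
  refine hbd.mono' ((continuous_charExp Λ hα0).neg.cexp.aestronglyMeasurable)
    (Eventually.of_forall fun z => ?_)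
  rw [Complex.norm_exp, Complex.neg_re]
  refine Real.exp_le_exp.2 ?_
  rcases eq_or_ne z 0 with rfl | hz
  · have : charExp d α Λ 0 = 0 := by
      rw [charExp_eq]
      simp [stableKernel, Real.zero_rpow hα0.ne']
    simp [this, Real.zero_rpow hα0.ne']
  · have hz0 : 0 < ‖z‖ := norm_pos_iff.2 hz
    have hz1 : z = ‖z‖ • (unitize z hz : Ed d) := by
      simp [unitize, smul_smul, hz0.ne']
    rw [hz1, charExp_eq_rpow_mul Λ hz0, Complex.re_ofReal_mul, ← hz1, neg_mul, mul_comm c]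
    gcongr
    exact (hcK _).1

end CharExp

section Projection

open MvPolynomial

variable {d : ℕ}

lemma continuous_gegenbauerN (b : ℝ) (j : ℕ) : Continuous (gegenbauerN b j) := by
  unfold gegenbauerN gegenbauer
  split_ifs
  · exact Polynomial.continuous _
  · fun_prop

lemma exists_gegenbauerN_bound (b : ℝ) (j : ℕ) :
    ∃ C : ℝ, 0 ≤ C ∧ ∀ u v : Sph d, ‖gegenbauerN b j ⟪(u : Ed d), (v : Ed d)⟫‖ ≤ C := by
  obtain ⟨C, hC⟩ := isCompact_Icc.exists_bound_of_continuousOn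
    (s := Set.Icc (-1 : ℝ) 1) (continuous_gegenbauerN b j).continuousOn
  refine ⟨C, (norm_nonneg _).trans (hC 0 (by norm_num)), fun u v => hC _ (abs_le.1 ?_)⟩
  simpa [norm_eq_of_mem_sphere] using abs_real_inner_le_norm (u : Ed d) (v : Ed d)

lemma ContCoeff.integrable_coeff_mul {Z : Sph d → MvPolynomial (Fin d) ℂ} (hZ : ContCoeff Z)
    {f : Sph d → ℂ} (hf : Integrable f (ωd d)) (s : Fin d →₀ ℕ) :
    Integrable (fun v => (Z v).coeff s * f v) (ωd d) := by
  obtain ⟨C, hC⟩ := isCompact_univ.exists_bound_of_continuousOn (hZ s).continuousOn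
  exact hf.bdd_mul (hZ s).aestronglyMeasurable (Eventually.of_forall fun v => hC v (Set.mem_univ v))

/-- Coefficientwise integration of a continuous family of homogeneous polynomials commutes with
linear functionals. -/
lemma exists_integral_homogeneous {Z : Sph d → MvPolynomial (Fin d) ℂ} (hZ : ContCoeff Z) {j : ℕ}
    (hh : ∀ v, (Z v).IsHomogeneous j) {f : Sph d → ℂ} (hf : Integrable f (ωd d)) :
    ∃ p : MvPolynomial (Fin d) ℂ, p.IsHomogeneous j ∧ ∀ l : MvPolynomial (Fin d) ℂ →ₗ[ℂ] ℂ,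
      l p = ∫ v, l (Z v) * f v ∂(ωd d) := by
  set S : Finset (Fin d →₀ ℕ) := Finset.univ.finsuppAntidiag j with hS
  have hmem : ∀ s : Fin d →₀ ℕ, s ∈ S ↔ s.degree = j := by
    intro s
    rw [hS, Finset.mem_finsuppAntidiag, Finsupp.degree_eq_sum]
    simp
  have hsum : ∀ v, Z v = ∑ s ∈ S, (Z v).coeff s • monomial s (1 : ℂ) := by
    intro v
    conv_lhs => rw [(Z v).as_sum]
    refine (Finset.sum_subset (fun s hs => (hmem s).2 ?_) fun s _ hs => ?_).trans
      (Finset.sum_congr rfl fun s _ => ?_)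
    · have := hh v (mem_support_iff.1 hs)
      rwa [Finsupp.degree_eq_weight_one (R := ℕ)]
    · rw [notMem_support_iff.1 hs, map_zero]
    · rw [smul_monomial, smul_eq_mul, mul_one]
  refine ⟨∑ s ∈ S, (∫ v, (Z v).coeff s * f v ∂(ωd d)) • monomial s (1 : ℂ), ?_, fun l => ?_⟩
  · refine IsHomogeneous.sum _ _ _ fun s hs => ?_
    rw [smul_monomial]
    exact isHomogeneous_monomial _ ((hmem s).1 hs)
  · have : ∀ v, l (Z v) * f v = ∑ s ∈ S, (Z v).coeff s * f v * l (monomial s 1) := by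
      intro v
      conv_lhs => rw [hsum v]
      rw [map_sum, Finset.sum_mul]
      refine Finset.sum_congr rfl fun s _ => ?_
      rw [map_smul, smul_eq_mul]
      ring
    simp_rw [this]
    rw [integral_finsetSum _ fun s _ => (hZ.integrable_coeff_mul hf s).mul_const _, map_sum]
    refine Finset.sum_congr rfl fun s _ => ?_
    rw [map_smul, smul_eq_mul, integral_mul_const]

lemma isSphericalHarmonicC_projC (j : ℕ) {f : Sph d → ℂ} (hf : Integrable f (ωd d)) :
    IsSphericalHarmonicC d j (projC d j f) := by
  obtain ⟨Z, hZ⟩ := exists_isZonal d j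
  obtain ⟨p, hp, hl⟩ := exists_integral_homogeneous hZ.cont hZ.homog hf
  refine ⟨C ((cdim d j : ℂ) / (sphereArea d : ℂ)) * p, ?_, ?_, fun u => ?_⟩
  · have := (isHomogeneous_C (Fin d) ((cdim d j : ℂ) / (sphereArea d : ℂ))).mul hp
    rwa [zero_add] at this
  · change lap _ = 0
    have h0 : lap p = 0 := by
      ext t
      have := hl (lcoeff ℂ t ∘ₗ ∑ i, (pderiv i).toLinearMap ∘ₗ (pderiv i).toLinearMap)
      have h2 : ∀ q : MvPolynomial (Fin d) ℂ, (lcoeff ℂ t ∘ₗ ∑ i, (pderiv i).toLinearMap ∘ₗ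
          (pderiv i).toLinearMap) q = (lap q).coeff t := by
        intro q
        simp [lap, coeff_sum]
      simp only [h2, hZ.harm, coeff_zero, zero_mul, integral_zero] at this
      rw [this, coeff_zero]
    rw [lap_C_mul, h0, mul_zero]
  · have := hl (aeval (R := ℂ) (fun i => ((u : Ed d) i : ℂ))).toLinearMap
    simp only [AlgHom.toLinearMap_apply, aeval_eq_eval] at this
    rw [map_mul, eval_C]
    refine congrArg _ (Eq.trans ?_ this.symm)
    refine integral_congr_ae (Eventually.of_forall fun v => ?_)
    have h2 := hZ.eval_eq v u
    rw [evalR] at h2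
    simp only
    rw [← real_inner_comm, ← h2]

end Projection

section Coefficients

/-- The scalar factor of `phiTerm`. -/
def phiCoef (d : ℕ) (α : ℝ) (j k : ℕ) (ρ : ℝ) : ℝ :=
  (-((2 : ℝ) ^ α)) ^ k * Real.pi ^ (-(d : ℝ) / 2) /
      ((Nat.factorial k : ℝ) * ρ ^ ((k : ℝ) * α + d)) *
      (Real.Gamma (((j : ℝ) + k * α + d) / 2) / Real.Gamma (((j : ℝ) - k * α) / 2))

lemma phiTerm_eq (d : ℕ) (α : ℝ) (Λ : Measure (Sph d)) (j k : ℕ) (ρ : ℝ) (u : Sph d) :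
    phiTerm d α Λ j k ρ u = phiCoef d α j k ρ * SHk d α Λ j k u := rfl

lemma norm_phiCoef_le {d : ℕ} {α : ℝ} (hα0 : 0 < α) (j k : ℕ) {c ρ : ℝ} (hc : 0 < c)
    (hρ : c ≤ ρ) : ‖phiCoef d α j k ρ‖ ≤ ‖phiCoef d α j k c‖ := by
  unfold phiCoef
  have h1 : c ^ ((k : ℝ) * α + d) ≤ ρ ^ ((k : ℝ) * α + d) := by gcongr
  have h0 : 0 < c ^ ((k : ℝ) * α + d) := by positivity
  simp only [norm_mul, norm_div]
  rw [norm_of_nonneg h0.le, norm_of_nonneg (h0.le.trans h1)]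
  have hk : (0 : ℝ) < ‖(k.factorial : ℝ)‖ := norm_pos_iff.2 (by positivity)
  gcongr

lemma phiCoef_eq {d : ℕ} (hd : 2 ≤ d) {α : ℝ} (hα0 : 0 < α) (j k : ℕ) {r : ℝ} (hr : 0 < r) :
    (((2 * π) ^ d)⁻¹ * r ^ j * fhConst d j : ℝ) * ((-1 : ℂ) ^ k / k.factorial *
      (((r ^ (-((d : ℝ) + j + k * α)) * Real.Gamma ((d : ℝ) + j + k * α) : ℝ) : ℂ) *
        ctrInt (2 * j + d - 2) 0 (((d : ℝ) + j + k * α : ℝ) : ℂ))) = phiCoef d α j k r := by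
  have hβ : 0 < (d : ℝ) + j + k * α := by positivity
  have hN : ((2 * j + d - 2 : ℕ) : ℝ) = 2 * j + d - 2 := by
    rw [Nat.cast_sub (by omega)]; push_cast; ring
  rw [Complex.ofReal_mul (r ^ (-((d : ℝ) + j + k * α))), mul_assoc (((r ^ _ : ℝ)) : ℂ),
    Gamma_mul_ctrInt _ hβ]
  rw [show (-1 : ℂ) ^ k / k.factorial = (((-1 : ℝ) ^ k / k.factorial : ℝ) : ℂ) by push_cast; rfl]
  simp only [← Complex.ofReal_mul]
  congr 1
  unfold phiCoef fhConst
  have hG : 0 < Real.Gamma (((2 * j + d - 2 : ℕ) + 1 : ℝ) / 2) :=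
    Real.Gamma_pos_of_pos (by positivity)
  rw [show ((2 * j + d - 2 : ℕ) + 2 - ((d : ℝ) + j + k * α)) / 2 = (j - k * α) / 2 by
      rw [hN]; ring,
    show ((d : ℝ) + j + k * α) / 2 = (j + k * α + d) / 2 by ring]
  have hr1 : r ^ (-((d : ℝ) + j + k * α)) = (r ^ j)⁻¹ * (r ^ ((k : ℝ) * α + d))⁻¹ := by
    rw [← Real.rpow_natCast r j, ← Real.rpow_neg hr.le, ← Real.rpow_neg hr.le,
      ← Real.rpow_add hr]
    congr 1; ring
  have h2 : (2 : ℝ) ^ ((d : ℝ) + j + k * α - 1) * 2 ^ (1 - (j : ℝ)) = 2 ^ d * (2 ^ α) ^ k := by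
    rw [← Real.rpow_natCast, ← Real.rpow_natCast, ← Real.rpow_mul (by norm_num),
      ← Real.rpow_add (by norm_num), ← Real.rpow_add (by norm_num)]
    congr 1; ring
  have hπ : π ^ (((d : ℝ) - 1) / 2) * √π = π ^ d * π ^ (-(d : ℝ) / 2) := by
    rw [Real.sqrt_eq_rpow, ← Real.rpow_natCast, ← Real.rpow_add pi_pos, ← Real.rpow_add pi_pos]
    congr 1; ring
  have hr2 : r ^ ((k : ℝ) * α + d) ≠ 0 := by positivity
  rw [hr1, neg_pow ((2 : ℝ) ^ α), mul_pow]
  generalize Real.Gamma (((2 * j + d - 2 : ℕ) + 1 : ℝ) / 2) = A at *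
  generalize Real.Gamma ((j + k * α + d) / 2) / Real.Gamma ((j - k * α) / 2) = B
  generalize (2 : ℝ) ^ ((d : ℝ) + j + k * α - 1) = x at *
  generalize (2 : ℝ) ^ (1 - (j : ℝ)) = y at *
  generalize π ^ (((d : ℝ) - 1) / 2) = z at *
  generalize π ^ (-(d : ℝ) / 2) = t at *
  have h3 : x * y * (z * √π) = 2 ^ d * (2 ^ α) ^ k * (π ^ d * t) := by rw [h2, hπ]
  have hAA := hG.ne'
  field_simp
  linear_combination B * h3

lemma summable_norm_phiCoef_mul {d : ℕ} (hd : 2 ≤ d) {α : ℝ} (hα0 : 0 < α) (hα1 : α < 1) (j : ℕ)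
    {r K : ℝ} (hr : 0 < r) (hK : 0 ≤ K) : Summable fun k => ‖phiCoef d α j k r‖ * K ^ k := by
  obtain ⟨C, hC⟩ := exists_ctrInt_bound (2 * j + d - 2)
  set a : ℝ := ((2 * π) ^ d)⁻¹ * r ^ j * fhConst d j with ha
  have hD : (0 : ℝ) < d + j := by positivity
  have hs := (summable_Gamma_mul_pow_div_factorial hα0 hα1 hD
    (M := r ^ (-α) * K) (by positivity)).mul_left (|a| * r ^ (-((d : ℝ) + j)) * C)
  refine hs.of_nonneg_of_le (fun k => by positivity) fun k => ?_
  have hβ : 0 < (d : ℝ) + j + k * α := by positivity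
  have hG := Real.Gamma_pos_of_pos hβ
  have h1 := hC 0 _ le_rfl hβ.le
  have h2 : ‖phiCoef d α j k r‖ = ‖(phiCoef d α j k r : ℂ)‖ := by simp
  rw [h2, ← phiCoef_eq hd hα0 j k hr]
  rw [← ha]
  simp only [norm_mul, norm_div, norm_pow, norm_neg, norm_one, one_pow, Complex.norm_natCast,
    Complex.norm_real, Real.norm_eq_abs] at h1 ⊢
  rw [rpow_neg_add_natCast_mul hr, abs_of_pos hG,
    abs_of_pos (a := r ^ (-((d : ℝ) + j)) * (r ^ (-α)) ^ k) (by positivity)]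
  calc _ ≤ |a| * (1 / k.factorial * (r ^ (-((d : ℝ) + j)) * (r ^ (-α)) ^ k *
        Real.Gamma (d + j + k * α) * C)) * K ^ k := by gcongr
    _ = _ := by rw [mul_pow]; ring

end Coefficients

section FourierInversion

variable {d : ℕ} {α : ℝ}

lemma integrable_harmonic_mul_fourier {E : Ed d → ℂ} (hE : Integrable E)
    (p : MvPolynomial (Fin d) ℂ) (r : ℝ) :
    Integrable (Function.uncurry fun (v : Sph d) (z : Ed d) => evalR p v *
      (Complex.exp (-(Complex.I * (⟪r • (v : Ed d), z⟫ : ℝ))) * E z)) ((ωd d).prod volume) := by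
  have h1 : Integrable (fun v : Sph d => evalR p v) (ωd d) :=
    integrable_sphere ((continuous_evalR p).comp continuous_subtype_val)
  have h2 : Continuous fun q : Sph d × Ed d =>
      Complex.exp (-(Complex.I * (⟪r • (q.1 : Ed d), q.2⟫ : ℝ))) := by fun_prop
  refine ((h1.mul_prod hE).bdd_mul (c := 1) h2.aestronglyMeasurable
    (Eventually.of_forall fun q => ?_)).congr (Eventually.of_forall fun q => ?_)
  · simp [Complex.norm_exp]
  · simp only [Function.uncurry]
    ring

/-- The integral of a spherical harmonic against a Fourier transform, in polar coordinates. -/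
lemma integral_harmonic_mul_fourier (hd : 2 ≤ d) {E : Ed d → ℂ} (hE : Integrable E)
    {p : MvPolynomial (Fin d) ℂ} {j : ℕ} (hp : p.IsHomogeneous j) (hl : lap p = 0) (r : ℝ) :
    ∫ v : Sph d, evalR p v *
      (∫ z : Ed d, Complex.exp (-(Complex.I * (⟪r • (v : Ed d), z⟫ : ℝ))) * E z) ∂(ωd d) =
    ∫ w : Sph d, evalR p w * ((-Complex.I) ^ j * ((r ^ j * fhConst d j : ℝ) : ℂ) *
      ∫ ρ in Set.Ioi (0 : ℝ), ((ρ ^ (d + j - 1) : ℝ) : ℂ) * E (ρ • (w : Ed d)) *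
        besselKernel (2 * j + d - 2) (r * ρ)) ∂(ωd d) := by
  have hint := integrable_harmonic_mul_fourier hE p r
  simp_rw [← integral_const_mul]
  rw [integral_integral_swap hint]
  have hH := hint.integral_prod_right
  simp only [Function.uncurry] at hH
  rw [integral_polar (by omega) hH]
  refine integral_congr_ae (Eventually.of_forall fun w => ?_)
  simp only
  refine setIntegral_congr_fun measurableSet_Ioi fun ρ hρ => ?_
  have hfh := funk_hecke_exp hd hp hl w (-(Complex.I * (r * ρ : ℝ)))
  have h1 : ∀ v : Sph d, evalR p v *
      (Complex.exp (-(Complex.I * (⟪r • (v : Ed d), ρ • (w : Ed d)⟫ : ℝ))) * E (ρ • (w : Ed d))) =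
      evalR p v * Complex.exp (-(Complex.I * (r * ρ : ℝ)) * (⟪(w : Ed d), (v : Ed d)⟫ : ℝ)) *
        E (ρ • (w : Ed d)) := by
    intro v
    rw [real_inner_smul_left, real_inner_smul_right, real_inner_comm, mul_assoc]
    congr 3
    push_cast
    ring_nf
  simp only [h1]
  rw [integral_mul_const, hfh]
  have h2 : ∫ φ in (-(π / 2))..(π / 2), Complex.exp (-(Complex.I * (r * ρ : ℝ)) *
      (Real.sin φ : ℝ)) * (Real.cos φ ^ (2 * j + d - 2) : ℝ) =
      besselKernel (2 * j + d - 2) (r * ρ) := by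
    unfold besselKernel
    congr 1
    funext φ
    push_cast
    ring_nf
  rw [h2, show d + j - 1 = (d - 1) + j by omega]
  push_cast
  rw [pow_add, show -(Complex.I * (r * ρ)) = -Complex.I * r * ρ by ring, mul_pow, mul_pow]
  ring

variable (Λ : Measure (Sph d)) [IsFiniteMeasure Λ]

lemma hasSum_integral_harmonic_mul_fourier (hd : 2 ≤ d) (hα0 : 0 < α) (hα1 : α < 1)
    (hpos : ∀ u, 0 < (Vfun d α Λ u).re) {p : MvPolynomial (Fin d) ℂ} {j : ℕ}
    (hp : p.IsHomogeneous j) (hl : lap p = 0) {r : ℝ} (hr : 0 < r) :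
    HasSum (fun k => (phiCoef d α j k r : ℂ) * ((-Complex.I) ^ j *
        ∫ w, evalR p w * Vfun d α Λ w ^ k ∂(ωd d)))
      (∫ v : Sph d, evalR p v * ((((2 * π) ^ d)⁻¹ : ℝ) *
        ∫ z : Ed d, Complex.exp (-(Complex.I * (⟪r • (v : Ed d), z⟫ : ℝ))) *
          Complex.exp (-charExp d α Λ z)) ∂(ωd d)) := by
  have hE := integrable_exp_neg_charExp Λ (by omega) hα0 hpos
  obtain ⟨c, K, hc, hcK⟩ := exists_Vfun_bounds Λ (by omega) hα0 hpos
  have hV := continuous_Vfun Λ hα0 (α := α)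
  have hpc : Continuous fun w : Sph d => evalR p w :=
    (continuous_evalR p).comp continuous_subtype_val
  set F : ℕ → Sph d → ℂ := fun k w =>
    (phiCoef d α j k r : ℂ) * ((-Complex.I) ^ j * (evalR p w * Vfun d α Λ w ^ k)) with hF
  have hFi : ∀ k, Integrable (F k) (ωd d) := fun k => integrable_sphere (by fun_prop)
  obtain ⟨B, hB⟩ := isCompact_univ.exists_bound_of_continuousOn hpc.continuousOn
  have hsum : Summable fun k => ∫ w, ‖F k w‖ ∂(ωd d) := by
    have hs := (summable_norm_phiCoef_mul hd hα0 hα1 j hr (abs_nonneg K)).mul_right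
      (|B| * (ωd d).real Set.univ)
    refine hs.of_nonneg_of_le (fun k => integral_nonneg fun _ => norm_nonneg _) fun k => ?_
    calc _ ≤ ∫ _ : Sph d, ‖phiCoef d α j k r‖ * |K| ^ k * |B| ∂(ωd d) := by
          refine integral_mono (hFi k).norm (integrable_const _) fun w => ?_
          simp only [hF, norm_mul, norm_pow, norm_neg, Complex.norm_I, one_pow, one_mul,
            Complex.norm_real]
          rw [mul_assoc, mul_comm (|K| ^ k)]
          gcongr
          · exact (hB w (Set.mem_univ w)).trans (le_abs_self B)
          · exact (hcK w).2.trans (le_abs_self K)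
      _ = _ := by
          rw [integral_const, smul_eq_mul]
          ring
  have h := hasSum_integral_of_summable_integral_norm hFi hsum
  have e1 : ∀ k, ∫ w, F k w ∂(ωd d) = (phiCoef d α j k r : ℂ) * ((-Complex.I) ^ j *
      ∫ w, evalR p w * Vfun d α Λ w ^ k ∂(ωd d)) := fun k => by
    simp only [hF, integral_const_mul]
  simp only [e1] at h
  refine Eq.subst (motive := fun s => HasSum _ s) (Eq.symm ?_) h
  have h3 : ∀ v : Sph d, ∀ y : ℂ, evalR p v * ((((2 * π) ^ d)⁻¹ : ℝ) * y) =
      (((2 * π) ^ d)⁻¹ : ℝ) * (evalR p v * y) := fun v y => by ring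
  simp only [h3]
  rw [integral_const_mul, integral_harmonic_mul_fourier hd hE hp hl, ← integral_const_mul]
  refine integral_congr_ae (Eventually.of_forall fun w => ?_)
  simp only
  have hD : (0 : ℝ) < d + j := by positivity
  have hrad := hasSum_radial (2 * j + d - 2) hα0 hα1 hD hr (hpos w)
  have e2 : ∫ ρ in Set.Ioi (0 : ℝ), ((ρ ^ (d + j - 1) : ℝ) : ℂ) *
      Complex.exp (-charExp d α Λ (ρ • (w : Ed d))) * besselKernel (2 * j + d - 2) (r * ρ) =
      ∫ ρ in Set.Ioi (0 : ℝ), ((ρ ^ ((d : ℝ) + j - 1) : ℝ) : ℂ) *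
        Complex.exp (-((ρ ^ α : ℝ) * Vfun d α Λ w)) * besselKernel (2 * j + d - 2) (r * ρ) := by
    refine setIntegral_congr_fun measurableSet_Ioi fun ρ hρ => ?_
    rw [charExp_eq_rpow_mul Λ hρ, ← Real.rpow_natCast, Nat.cast_sub (by omega)]
    push_cast
    rfl
  rw [e2]
  refine Eq.symm (HasSum.tsum_eq ?_)
  have h4 := hrad.mul_left ((((2 * π) ^ d)⁻¹ * r ^ j * fhConst d j : ℝ) *
    ((-Complex.I) ^ j * evalR p w))
  refine (congr_arg₂ (fun a b => HasSum a b) (funext fun k => ?_) ?_).mpr h4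
  · simp only [hF]
    rw [← phiCoef_eq hd hα0 j k hr, neg_pow (Vfun d α Λ w)]
    ring
  · push_cast
    ring

end FourierInversion

section Density

variable {d : ℕ} {α : ℝ} (Λ : Measure (Sph d))

lemma phiTerm_zero (hd : 0 < d) (j : ℕ) (r : ℝ) (u : Sph d) : phiTerm d α Λ j 0 r u = 0 := by
  rcases eq_or_ne j 0 with rfl | hj
  · simp [phiTerm_eq, phiCoef]
  · obtain ⟨Z, hZ⟩ := exists_isZonal d j
    have h := integral_sphere_harmonic hd hj (hZ.homog u) (hZ.harm u)
    simp only [hZ.eval_eq] at h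
    simp only [phiTerm_eq, SHk, projC, pow_zero, mul_one, h, mul_zero]

variable [IsFiniteMeasure Λ]

lemma hasSum_phiTerm (hd : 2 ≤ d) (hα0 : 0 < α) (hα1 : α < 1)
    (hpos : ∀ u, 0 < (Vfun d α Λ u).re) {g : Ed d → ℝ} (hg : IsDensityOf d α Λ g) (j : ℕ)
    {r : ℝ} (hr : 0 < r) (u : Sph d) :
    HasSum (fun k => phiTerm d α Λ j k r u)
      (projC d j (fun v => (g (r • (v : Ed d)) : ℂ)) u) := by
  obtain ⟨Z, hZ⟩ := exists_isZonal d j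
  have h := (hasSum_integral_harmonic_mul_fourier Λ hd hα0 hα1 hpos (hZ.homog u) (hZ.harm u)
    hr).mul_left ((cdim d j : ℂ) / (sphereArea d : ℂ))
  simp only [hZ.eval_eq, ← hg _] at h
  refine h.congr_fun fun k => ?_
  rw [phiTerm_eq, SHk, projC]
  ring

lemma hasSum_phiTerm_succ (hd : 2 ≤ d) (hα0 : 0 < α) (hα1 : α < 1)
    (hpos : ∀ u, 0 < (Vfun d α Λ u).re) {g : Ed d → ℝ} (hg : IsDensityOf d α Λ g) (j : ℕ)
    {r : ℝ} (hr : 0 < r) (u : Sph d) :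
    HasSum (fun k => phiTerm d α Λ j (k + 1) r u)
      (projC d j (fun v => (g (r • (v : Ed d)) : ℂ)) u) := by
  rw [hasSum_nat_add_iff (f := fun k => phiTerm d α Λ j k r u) 1]
  simpa [phiTerm_zero Λ (by omega : 0 < d)] using hasSum_phiTerm Λ hd hα0 hα1 hpos hg j hr u

lemma integrable_density_smul (hd : 0 < d) (hα0 : 0 < α) (hpos : ∀ u, 0 < (Vfun d α Λ u).re)
    {g : Ed d → ℝ} (hg : IsDensityOf d α Λ g) (r : ℝ) :
    Integrable (fun v : Sph d => (g (r • (v : Ed d)) : ℂ)) (ωd d) := by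
  have h := ((integrable_harmonic_mul_fourier (integrable_exp_neg_charExp Λ hd hα0 hpos) 1
    r).integral_prod_left).const_mul ((((2 * π) ^ d)⁻¹ : ℝ) : ℂ)
  refine h.congr (Eventually.of_forall fun v => ?_)
  simp [hg (r • (v : Ed d)), Function.uncurry, evalR]

lemma exists_norm_SHk_le (hd : 0 < d) (hα0 : 0 < α) (hpos : ∀ u, 0 < (Vfun d α Λ u).re) (j : ℕ) :
    ∃ A K : ℝ, 0 ≤ K ∧ ∀ k u, ‖SHk d α Λ j k u‖ ≤ A * K ^ k := by
  obtain ⟨c, K, hc, hcK⟩ := exists_Vfun_bounds Λ hd hα0 hpos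
  obtain ⟨C, hC0, hC⟩ := exists_gegenbauerN_bound (d := d) (((d : ℝ) - 2) / 2) j
  refine ⟨‖(cdim d j : ℂ) / (sphereArea d : ℂ)‖ * (C * (ωd d).real Set.univ), |K|, abs_nonneg K,
    fun k u => ?_⟩
  rw [SHk, projC, norm_mul, norm_mul, norm_pow, norm_neg, Complex.norm_I, one_pow, one_mul,
    mul_assoc]
  gcongr
  calc _ ≤ C * |K| ^ k * (ωd d).real Set.univ := by
        refine norm_integral_le_of_norm_le_const (Eventually.of_forall fun v => ?_)
        rw [norm_mul, norm_pow, Complex.norm_real]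
        gcongr
        · exact hC u v
        · exact (hcK v).2.trans (le_abs_self K)
    _ = _ := by ring

lemma exists_summable_norm_phiTerm_le (hd : 2 ≤ d) (hα0 : 0 < α) (hα1 : α < 1)
    (hpos : ∀ u, 0 < (Vfun d α Λ u).re) (j : ℕ) {c : ℝ} (hc : 0 < c) :
    ∃ M : ℕ → ℝ, Summable M ∧
      ∀ (k : ℕ) (ρ : ℝ) (u : Sph d), c ≤ ρ → ‖phiTerm d α Λ j k ρ u‖ ≤ M k := by
  obtain ⟨A, K, hK, hA⟩ := exists_norm_SHk_le Λ (by omega) hα0 hpos j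
  refine ⟨fun k => A * (‖phiCoef d α j k c‖ * K ^ k),
    (summable_norm_phiCoef_mul hd hα0 hα1 j hc hK).mul_left A, fun k ρ u hρ => ?_⟩
  rw [phiTerm_eq, norm_mul, Complex.norm_real]
  calc _ ≤ ‖phiCoef d α j k c‖ * (A * K ^ k) :=
        mul_le_mul (norm_phiCoef_le hα0 j k hc hρ) (hA k u) (norm_nonneg _) (norm_nonneg _)
    _ = _ := by ring

end Density

end StablePaper

namespace StablePaper

/-- Proposition (general spectral measure, `α ∈ (0,1)`): the series
`φ_j(x) = Σ_{k≥1} ((-2^α)^k π^{-d/2}/(k!|x|^{kα+d})) (Γ((j+kα+d)/2)/Γ((j-kα)/2)) S_{j,k}(u_x)`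
converges absolutely, uniformly on `{|x| ≥ c}`; for every `r > 0`, `φ_j(r·) ∈ ℋ_{j,d}`
and `proj_j (g(r·)) = φ_j(r·)`. -/
theorem stmt11 (d : ℕ) (hd : 2 ≤ d) (α : ℝ) (hα0 : 0 < α) (hα1 : α < 1)
    (Λ : Measure (Sph d)) [IsFiniteMeasure Λ] (hΛ : Λ ≠ 0)
    (μ : Measure (Ed d)) [IsProbabilityMeasure μ] (hμ : IsStableChar d α Λ μ)
    (hnd : Nondegenerate d μ)
    (g : Ed d → ℝ) (hg : IsDensityOf d α Λ g) (j : ℕ) :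
    (∀ c : ℝ, 0 < c → ∃ M : ℕ → ℝ, Summable M ∧
      ∀ (k : ℕ) (ρ : ℝ) (u : Sph d), c ≤ ρ → ‖phiTerm d α Λ j (k + 1) ρ u‖ ≤ M k) ∧
    (∀ r : ℝ, 0 < r →
      IsSphericalHarmonicC d j (fun u => ∑' k : ℕ, phiTerm d α Λ j (k + 1) r u) ∧
      ∀ u : Sph d,
        projC d j (fun v => (g (r • (v : Ed d)) : ℂ)) u =
          ∑' k : ℕ, phiTerm d α Λ j (k + 1) r u) := by
  have hpos := Vfun_re_pos Λ hα0 hμ hnd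
  refine ⟨fun c hc => ?_, fun r hr => ?_⟩
  · obtain ⟨M, hM, hle⟩ := exists_summable_norm_phiTerm_le Λ hd hα0 hα1 hpos j hc
    exact ⟨fun k => M (k + 1), (summable_nat_add_iff 1).2 hM, fun k ρ u hρ => hle (k + 1) ρ u hρ⟩
  · have h : ∀ u, projC d j (fun v => (g (r • (v : Ed d)) : ℂ)) u =
        ∑' k : ℕ, phiTerm d α Λ j (k + 1) r u := fun u =>
      (hasSum_phiTerm_succ Λ hd hα0 hα1 hpos hg j hr u).tsum_eq.symm
    refine ⟨?_, h⟩
    rw [← funext h]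
    exact isSphericalHarmonicC_projC j (integrable_density_smul Λ (by omega) hα0 hpos hg r)

end StablePaper
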